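/- For every n̂ ∈ C⁰(P̂), the sum of the wrapping numbers over all cleaved faces vanishes: ∑_{a=1}^v w^a(n̂) = 0. -/

import Mathlib

open Matrix Set MeasureTheory
open scoped Classical

noncomputable section

/-- Points of `ℝ³`. -/
abbrev V3 := Fin 3 → ℝ

/-- The unit sphere `S² ⊂ ℝ³`. -/
def sphereS : Set V3 := {x | x ⬝ᵥ x = 1}

/-- Rodrigues rotation of `v` by angle `θ` about the unit axis `F`. -/
def rot3 (F : V3) (θ : ℝ) (v : V3) : V3 :=
  Real.cos θ • v + Real.sin θ • (crossProduct F v) + ((1 - Real.cos θ) * (F ⬝ᵥ v)) • F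

/-- The point at fraction `ρ` of arclength along the shortest geodesic on the
unit sphere from `p` to `a` (for `a ≠ -p`). -/
def geo (p a : V3) (ρ : ℝ) : V3 :=
  if p = a then p
  else (Real.sin ((1 - ρ) * Real.arccos (p ⬝ᵥ a)) / Real.sin (Real.arccos (p ⬝ᵥ a))) • p +
       (Real.sin (ρ * Real.arccos (p ⬝ᵥ a)) / Real.sin (Real.arccos (p ⬝ᵥ a))) • a

/-- `ξ` is the continuous angle lift of the tangent field `n` along the path `z`
(defined on `[0,1]`), `η ∈ (-π,π)` the smallest-magnitude angle between the endpoint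
values, and `κ` the resulting kink number: `2πκ = ξ(1) - η`. -/
def IsKinkAlong (Fn : V3) (n : V3 → V3) (z : ℝ → V3) (κ : ℤ) : Prop :=
  ∃ ξ : ℝ → ℝ, ContinuousOn ξ (Set.Icc 0 1) ∧ ξ 0 = 0 ∧
    (∀ t ∈ Set.Icc (0:ℝ) 1, n (z t) = rot3 Fn (ξ t) (n (z 0))) ∧
    ∃ η : ℝ, η ∈ Set.Ioo (-Real.pi) Real.pi ∧ n (z 1) = rot3 Fn η (n (z 0)) ∧
      2 * Real.pi * (κ : ℝ) = ξ 1 - η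

/-- `z` is a `2π`-periodic parameterization of a loop around the centre `ctr`, lying in the
plane through `ctr` with normal `N`, positively oriented with respect to `N` (the angle
`θ` increases by `2π` over a period). -/
def PosLoopParam (N ctr : V3) (z : ℝ → V3) : Prop :=
  Continuous z ∧ (∀ φ, z (φ + 2 * Real.pi) = z φ) ∧
  ∃ e₁ e₂ : V3, e₁ ⬝ᵥ e₁ = 1 ∧ e₂ ⬝ᵥ e₂ = 1 ∧ e₁ ⬝ᵥ e₂ = 0 ∧ crossProduct e₁ e₂ = N ∧
    ∃ θ r : ℝ → ℝ, Continuous θ ∧ Monotone θ ∧ (∀ φ, θ (φ + 2 * Real.pi) = θ φ + 2 * Real.pi) ∧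
      (∀ φ, 0 < r φ) ∧
      ∀ φ, z φ = ctr + r φ • (Real.cos (θ φ) • e₁ + Real.sin (θ φ) • e₂)

/-- The map `S² → S²` obtained by gluing, along the equator, the map
`ν(ρ,φ) = n(ρ z(φ) + (1-ρ) ctr)` (on the upper hemisphere) with the map
`ν₀(ρ,φ) = g_ρ(-s, n(z(φ)))` (on the lower hemisphere), where `(ρ,φ)` are the polar
coordinates of the first two coordinates. -/
def wrapMap (n : V3 → V3) (z : ℝ → V3) (ctr s : V3) : V3 → V3 := fun x =>
  if 0 ≤ x 2 then
    n ((Real.sqrt ((x 0) ^ 2 + (x 1) ^ 2)) • z (Complex.arg ((x 0 : ℂ) + (x 1 : ℂ) * Complex.I))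
      + (1 - Real.sqrt ((x 0) ^ 2 + (x 1) ^ 2)) • ctr)
  else
    geo (-s) (n (z (Complex.arg ((x 0 : ℂ) + (x 1 : ℂ) * Complex.I))))
      (Real.sqrt ((x 0) ^ 2 + (x 1) ^ 2))

/-- Homotopy of maps of the unit sphere `S²` to itself. -/
def SphHomotopic (f g : V3 → V3) : Prop :=
  ∃ H : ℝ → V3 → V3,
    ContinuousOn (fun q : ℝ × V3 => H q.1 q.2) (Set.Icc (0:ℝ) 1 ×ˢ sphereS) ∧
    (∀ t ∈ Set.Icc (0:ℝ) 1, Set.MapsTo (H t) sphereS sphereS) ∧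
    (∀ x ∈ sphereS, H 0 x = f x) ∧ (∀ x ∈ sphereS, H 1 x = g x)

/-- The standard degree-`k` self-map of `S²`: in cylindrical coordinates it multiplies
the azimuthal angle by `k`, fixing the vertical coordinate. -/
def powMap (k : ℤ) : V3 → V3 := fun x =>
  if ((x 0 : ℂ) + (x 1 : ℂ) * Complex.I) = 0 then x
  else
    ![‖(x 0 : ℂ) + (x 1 : ℂ) * Complex.I‖ *
        ((((x 0 : ℂ) + (x 1 : ℂ) * Complex.I) /
          (‖(x 0 : ℂ) + (x 1 : ℂ) * Complex.I‖ : ℂ)) ^ k).re,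
      ‖(x 0 : ℂ) + (x 1 : ℂ) * Complex.I‖ *
        ((((x 0 : ℂ) + (x 1 : ℂ) * Complex.I) /
          (‖(x 0 : ℂ) + (x 1 : ℂ) * Complex.I‖ : ℂ)) ^ k).im,
      x 2]

/-- `deg` is a Brouwer degree for self-maps of `S²`: it is invariant under homotopy of
continuous self-maps of the sphere, and assigns degree `k` to the standard map `powMap k`.
(These axioms determine `deg` uniquely on continuous self-maps of `S²`, by Hopf's theorem.) -/
def DegreeTheory (deg : (V3 → V3) → ℤ) : Prop :=
  (∀ f g : V3 → V3, ContinuousOn f sphereS → Set.MapsTo f sphereS sphereS →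
      ContinuousOn g sphereS → Set.MapsTo g sphereS sphereS →
      SphHomotopic f g → deg f = deg g) ∧
  (∀ k : ℤ, deg (powMap k) = k)

/-- The pullback under `u : ℝ² → S²` of the (normalized) area 2-form of `S²`,
evaluated on the standard basis of `ℝ²`: `u ⋅ (∂₁ u × ∂₂ u)`. -/
def pullA (u : ℝ × ℝ → V3) (p : ℝ × ℝ) : ℝ :=
  u p ⬝ᵥ crossProduct (fderiv ℝ u p (1, 0)) (fderiv ℝ u p (0, 1))

/-- The integral `∫_A n*ω` of the pullback under `n` of the area form `ω` of `S²`, over a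
planar region `A` lying in the plane through `o` spanned by the orthonormal pair `e₁, e₂`
(the pair orienting the plane). -/
def faceInt (n : V3 → V3) (o e₁ e₂ : V3) (A : Set V3) : ℝ :=
  ∫ p : ℝ × ℝ in {q : ℝ × ℝ | o + q.1 • e₁ + q.2 • e₂ ∈ A},
    pullA (fun q : ℝ × ℝ => n (o + q.1 • e₁ + q.2 • e₂)) p

/-- The 1-form `γ = (1 - cos α) dβ` on `S² - {s}` (where `(α,β)` are spherical polar
coordinates with south pole at `s`, and `e₁, e₂` is an orthonormal azimuthal frame with
`e₁ ×₃ e₂ = -s`), evaluated at the point `v` on the tangent vector `w`. -/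
def gammaForm (s e₁ e₂ : V3) (v w : V3) : ℝ :=
  if (v ⬝ᵥ e₁) ^ 2 + (v ⬝ᵥ e₂) ^ 2 = 0 then 0
  else (1 + v ⬝ᵥ s) *
    (((v ⬝ᵥ e₁) * (w ⬝ᵥ e₂) - (v ⬝ᵥ e₂) * (w ⬝ᵥ e₁)) / ((v ⬝ᵥ e₁) ^ 2 + (v ⬝ᵥ e₂) ^ 2))

/-- The closed spherical geodesic triangle with vertices `a`, `b`, `c` (pairwise
non-antipodal): the radial projection to the sphere of the planar triangle with these
vertices. Its sides are the shortest geodesic arcs joining consecutive vertices. -/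
def sphTri (a b c : V3) : Set V3 :=
  {x | ∃ α β γ : ℝ, 0 ≤ α ∧ 0 ≤ β ∧ 0 ≤ γ ∧ α • a + β • b + γ • c ≠ 0 ∧
    x = (Real.sqrt ((α • a + β • b + γ • c) ⬝ᵥ (α • a + β • b + γ • c)))⁻¹ •
      (α • a + β • b + γ • c)}

/-- The shortest geodesic arc on the sphere from `a` to `b` (for `a ≠ -b`). -/
def sphArc (a b : V3) : Set V3 :=
  {x | ∃ α β : ℝ, 0 ≤ α ∧ 0 ≤ β ∧ α • a + β • b ≠ 0 ∧
    x = (Real.sqrt ((α • a + β • b) ⬝ᵥ (α • a + β • b)))⁻¹ • (α • a + β • b)}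

/-- The oriented area `A(a,b,c)` of the spherical geodesic triangle with vertices
`a`, `b`, `c`: `A = 2 arg((1 + a⋅b + b⋅c + c⋅a) + i (a×b)⋅c)`, with `arg ∈ (-π, π]`. -/
def sphA (a b c : V3) : ℝ :=
  2 * Complex.arg (((1 + a ⬝ᵥ b + b ⬝ᵥ c + c ⬝ᵥ a : ℝ) : ℂ) +
    ((crossProduct a b ⬝ᵥ c : ℝ) : ℂ) * Complex.I)

/-- `σ(a,b,c)` relative to the point `s`: equal to `sgn((a×b)⋅s)` if `s` lies in the
spherical triangle with vertices `a`, `b`, `c`, and `0` otherwise. -/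
def sphSigma (s a b c : V3) : ℝ :=
  if s ∈ sphTri a b c then Real.sign (crossProduct a b ⬝ᵥ s) else 0

/-- A compact convex polyhedron `P̄ ⊂ ℝ³` with nonempty interior: its vertices `vert`,
faces `face` (with outward unit normals `Fnormal` and supporting planes
`{x | x ⋅ Fnormal c = foffset c}`), edges `edge` (segments between vertices), together
with the truncation data: for each vertex `a` a plane through `cpt a` with outward unit
normal `Cnormal a` separating `vert a` from the other vertices, the planes being pairwise
disjoint within `P̄`.  The combinatorial data records, for each face `c`, its `m c`
vertices `fvert c 0, fvert c 1, …` and edges `fedge c i` (from `fvert c i` to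
`fvert c (i+1)`) in cyclic order, positively oriented with respect to the outward normal;
and, for each vertex `a`, its `vm a` incident edges `vedge a i` and faces `vface a i`
(with `vface a i` containing the consecutive edges `vedge a i` and `vedge a (i+1)`) in
cyclic order, positively oriented with respect to the outward normal of the cleaved face. -/
structure PolyCtx where
  nv : ℕ
  ne : ℕ
  nf : ℕ
  Pbar : Set V3
  vert : Fin nv → V3
  face : Fin nf → Set V3
  Fnormal : Fin nf → V3
  foffset : Fin nf → ℝ
  edge : Fin ne → Set V3
  esrc : Fin ne → Fin nv
  etgt : Fin ne → Fin nv
  edgeDir : Fin ne → V3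
  cpt : Fin nv → V3
  Cnormal : Fin nv → V3
  m : Fin nf → ℕ
  fvert : Fin nf → ℕ → Fin nv
  fedge : Fin nf → ℕ → Fin ne
  vm : Fin nv → ℕ
  vedge : Fin nv → ℕ → Fin ne
  vface : Fin nv → ℕ → Fin nf
  compact : IsCompact Pbar
  convex : Convex ℝ Pbar
  int_nonempty : (interior Pbar).Nonempty
  hull : Pbar = convexHull ℝ (Set.range vert)
  vert_extreme : ∀ a, vert a ∉ convexHull ℝ (Set.range vert \ {vert a})
  vert_inj : Function.Injective vert
  Fnormal_unit : ∀ c, Fnormal c ⬝ᵥ Fnormal c = 1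
  face_def : ∀ c, face c = {x ∈ Pbar | x ⬝ᵥ Fnormal c = foffset c}
  face_supp : ∀ c, ∀ x ∈ Pbar, x ⬝ᵥ Fnormal c ≤ foffset c
  frontier_eq : frontier Pbar = ⋃ c, face c
  edge_def : ∀ b, edge b = segment ℝ (vert (esrc b)) (vert (etgt b))
  edge_proper : ∀ b, esrc b ≠ etgt b
  edgeDir_unit : ∀ b, edgeDir b ⬝ᵥ edgeDir b = 1
  edgeDir_dir : ∀ b, ∃ lam : ℝ, 0 < lam ∧ vert (etgt b) - vert (esrc b) = lam • edgeDir b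
  edge_two_faces : ∀ b, ∃ c c', edge b ⊆ face c ∧ edge b ⊆ face c' ∧
    crossProduct (Fnormal c) (Fnormal c') ≠ 0
  Cnormal_unit : ∀ a, Cnormal a ⬝ᵥ Cnormal a = 1
  sep_vert : ∀ a, 0 < (vert a - cpt a) ⬝ᵥ Cnormal a
  sep_other : ∀ a a', a' ≠ a → (vert a' - cpt a) ⬝ᵥ Cnormal a < 0
  cleave_sub : ∀ a a' : Fin nv, ∀ x ∈ Pbar, (x - cpt a) ⬝ᵥ Cnormal a = 0 →
    (x - cpt a') ⬝ᵥ Cnormal a' ≤ 0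
  m_ge : ∀ c, 3 ≤ m c
  fvert_per : ∀ c i, fvert c (i + m c) = fvert c i
  fedge_per : ∀ c i, fedge c (i + m c) = fedge c i
  fvert_inj : ∀ c, ∀ i j : ℕ, i < j → j < m c → fvert c i ≠ fvert c j
  fedge_seg : ∀ c i, edge (fedge c i) = segment ℝ (vert (fvert c i)) (vert (fvert c (i + 1)))
  fedge_sub : ∀ c i, edge (fedge c i) ⊆ face c
  vm_ge : ∀ a, 3 ≤ vm a
  vedge_per : ∀ a i, vedge a (i + vm a) = vedge a i
  vface_per : ∀ a i, vface a (i + vm a) = vface a i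
  vedge_inj : ∀ a, ∀ i j : ℕ, i < j → j < vm a → vedge a i ≠ vedge a j
  vedge_mem : ∀ a i, vert a ∈ edge (vedge a i)
  vface_between : ∀ a i, edge (vedge a i) ⊆ face (vface a i) ∧
    edge (vedge a (i + 1)) ⊆ face (vface a i)

namespace PolyCtx

variable (P : PolyCtx)

/-- `P`: the polyhedron `P̄` with its vertices removed. -/
def Pset : Set V3 := P.Pbar \ Set.range P.vert

/-- The closed half-space `R^a` cut off by the cleaving plane at the vertex `a`. -/
def Rhalf (a : Fin P.nv) : Set V3 := {x | (x - P.cpt a) ⬝ᵥ P.Cnormal a ≤ 0}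

/-- The intersection of all the half-spaces `R^a`. -/
def Rall : Set V3 := ⋂ a, P.Rhalf a

/-- The truncated polyhedron `P̂ = P ∩ ⋂ₐ R^a`. -/
def PhatSet : Set V3 := P.Pset ∩ P.Rall

/-- The cleaved face `Ĉ^a = C^a ∩ P`. -/
def Chat (a : Fin P.nv) : Set V3 := {x | (x - P.cpt a) ⬝ᵥ P.Cnormal a = 0} ∩ P.Pset

/-- The truncated face `F̂^c = F^c ∩ ⋂ₐ R^a`. -/
def Fhat (c : Fin P.nf) : Set V3 := P.face c ∩ P.Rall

/-- The cleaved edge `B̂^{ac} = Ĉ^a ∩ F̂^c`. -/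
def Bhat (a : Fin P.nv) (c : Fin P.nf) : Set V3 := P.Chat a ∩ P.Fhat c

/-- The truncated edge `Ê^b = E^b ∩ ⋂ₐ R^a`. -/
def Ehat (b : Fin P.ne) : Set V3 := P.edge b ∩ P.Rall

/-- The boundary `∂Ĉ^a` of the cleaved face: the union of its cleaved edges. -/
def bdChat (a : Fin P.nv) : Set V3 := ⋃ c, P.Bhat a c

/-- The boundary `∂F̂^c` of the truncated face: its truncated edges and cleaved edges. -/
def bdFhat (c : Fin P.nf) : Set V3 :=
  (⋃ i ∈ Finset.range (P.m c), P.Ehat (P.fedge c i)) ∪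
    ⋃ i ∈ Finset.range (P.m c), P.Bhat (P.fvert c i) c

/-- The boundary `∂P̂` of the truncated polyhedron: cleaved faces and truncated faces. -/
def bdPhat : Set V3 := (⋃ a, P.Chat a) ∪ ⋃ c, P.Fhat c

/-- `n ∈ C⁰(P)`: a continuous unit-vector field on `P`, tangent to each face. -/
def MemC0P (n : V3 → V3) : Prop :=
  ContinuousOn n P.Pset ∧ (∀ x ∈ P.Pset, n x ∈ sphereS) ∧
  ∀ c, ∀ x ∈ P.face c ∩ P.Pset, n x ⬝ᵥ P.Fnormal c = 0

/-- `n ∈ C⁰(P̂)`: a continuous unit-vector field on `P̂`, tangent to each truncated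
face `F̂^c` (but not necessarily to the cleaved faces). -/
def MemC0Phat (n : V3 → V3) : Prop :=
  ContinuousOn n P.PhatSet ∧ (∀ x ∈ P.PhatSet, n x ∈ sphereS) ∧
  ∀ c, ∀ x ∈ P.Fhat c, n x ⬝ᵥ P.Fnormal c = 0

/-- Homotopy in `C⁰(P)`. -/
def HomotopicP (n n' : V3 → V3) : Prop :=
  ∃ H : ℝ → V3 → V3,
    ContinuousOn (fun q : ℝ × V3 => H q.1 q.2) (Set.Icc (0:ℝ) 1 ×ˢ P.Pset) ∧
    (∀ t ∈ Set.Icc (0:ℝ) 1, P.MemC0P (H t)) ∧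
    (∀ x ∈ P.Pset, H 0 x = n x) ∧ (∀ x ∈ P.Pset, H 1 x = n' x)

/-- Homotopy in `C⁰(P̂)`. -/
def HomotopicPhat (n n' : V3 → V3) : Prop :=
  ∃ H : ℝ → V3 → V3,
    ContinuousOn (fun q : ℝ × V3 => H q.1 q.2) (Set.Icc (0:ℝ) 1 ×ˢ P.PhatSet) ∧
    (∀ t ∈ Set.Icc (0:ℝ) 1, P.MemC0Phat (H t)) ∧
    (∀ x ∈ P.PhatSet, H 0 x = n x) ∧ (∀ x ∈ P.PhatSet, H 1 x = n' x)

/-- The edge orientation `e^b(n) = ε`: `n` has the constant value `ε` on `Ê^b`. -/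
def IsEdgeOrient (b : Fin P.ne) (n : V3 → V3) (ε : V3) : Prop :=
  ∀ x ∈ P.Ehat b, n x = ε

/-- `z : [0,1] → ℝ³` is a continuous injective parameterization of the cleaved edge
`B̂^{ac}`, positively oriented with respect to the outward normal `F^c` (the face
`F̂^c` lies on the positive side of `F^c × (z 1 - z 0)`). -/
def IsPosParamSeg (a : Fin P.nv) (c : Fin P.nf) (z : ℝ → V3) : Prop :=
  ContinuousOn z (Set.Icc 0 1) ∧ z '' Set.Icc 0 1 = P.Bhat a c ∧
  Set.InjOn z (Set.Icc 0 1) ∧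
  ∀ x ∈ P.Fhat c, 0 ≤ (x - z 0) ⬝ᵥ crossProduct (P.Fnormal c) (z 1 - z 0)

/-- The kink number `k^{ac}(n) = κ`. -/
def HasKink (a : Fin P.nv) (c : Fin P.nf) (n : V3 → V3) (κ : ℤ) : Prop :=
  ∃ z : ℝ → V3, P.IsPosParamSeg a c z ∧ IsKinkAlong (P.Fnormal c) n z κ

/-- `s ∈ S²` is admissible: not orthogonal to any face normal. -/
def AdmissibleS (s : V3) : Prop := s ∈ sphereS ∧ ∀ c, s ⬝ᵥ P.Fnormal c ≠ 0

/-- The wrapping number `w^a(n) = w`, computed (relative to a Brouwer degree `deg` and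
an admissible reference point `s`) as the degree of the map `S² → S²` glued from the
restriction of `n` to the cleaved face `Ĉ^a` and the geodesic contraction of its boundary
values to `-s`, using an interior point `ctr` of `Ĉ^a` and a positively oriented
`2π`-periodic parameterization `z` of `∂Ĉ^a`. -/
def HasWrap (deg : (V3 → V3) → ℤ) (s : V3) (a : Fin P.nv) (n : V3 → V3) (w : ℤ) : Prop :=
  ∃ ctr z, ctr ∈ P.Chat a ∧ ctr ∉ P.bdChat a ∧
    PosLoopParam (P.Cnormal a) ctr z ∧ Set.range z = P.bdChat a ∧
    deg (wrapMap n z ctr s) = w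

/-- `n` and `n'` have the same invariants: equal edge orientations, kink numbers and
wrapping numbers. -/
def SameInv (deg : (V3 → V3) → ℤ) (s : V3) (n n' : V3 → V3) : Prop :=
  (∀ b : Fin P.ne, Set.EqOn n n' (P.Ehat b)) ∧
  (∀ a c, ∀ κ : ℤ, P.HasKink a c n κ ↔ P.HasKink a c n' κ) ∧
  (∀ a, ∀ w : ℤ, P.HasWrap deg s a n w ↔ P.HasWrap deg s a n' w)

end PolyCtx

/-! ### General topological tools -/

theorem aux_quot {X Y Z : Type*} [TopologicalSpace X] [TopologicalSpace Y] [T2Space Y]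
    [TopologicalSpace Z] {A : Set X} {B : Set Y} (hA : IsCompact A) (q : X → Y)
    (hq : ContinuousOn q A) (hB : B ⊆ q '' A) (hm : MapsTo q A B) (G : Y → Z)
    (hG : ContinuousOn (fun x => G (q x)) A) : ContinuousOn G B := by
  have : CompactSpace A := isCompact_iff_compactSpace.1 hA
  let Q : A → B := fun x => ⟨q x, hm x.2⟩
  have hQ : Continuous Q := by
    refine Continuous.subtype_mk ?_ _
    exact continuousOn_iff_continuous_domRestrict.1 hq
  have hs : Function.Surjective Q := by
    rintro ⟨y, hy⟩
    obtain ⟨x, hx, rfl⟩ := hB hy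
    exact ⟨⟨x, hx⟩, rfl⟩
  have hquot : Topology.IsQuotientMap Q := hQ.isClosedMap.isQuotientMap hQ hs
  rw [continuousOn_iff_continuous_domRestrict, hquot.continuous_iff]
  exact continuousOn_iff_continuous_domRestrict.1 hG

theorem aux_glue {ι X Y : Type*} [Finite ι] [TopologicalSpace X] [TopologicalSpace Y]
    [Nonempty Y] (A : ι → Set X) (hA : ∀ i, IsClosed (A i)) (F : ι → X → Y)
    (hF : ∀ i, ContinuousOn (F i) (A i))
    (hc : ∀ i j x, x ∈ A i → x ∈ A j → F i x = F j x) :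
    ∃ U : X → Y, ContinuousOn U (⋃ i, A i) ∧ ∀ i, ∀ x ∈ A i, U x = F i x := by
  let U : X → Y := fun x => if h : ∃ i, x ∈ A i then F h.choose x else Classical.arbitrary Y
  have hU : ∀ i, ∀ x ∈ A i, U x = F i x := by
    intro i x hx
    have h : ∃ i, x ∈ A i := ⟨i, hx⟩
    simp only [U, dif_pos h]
    exact hc _ _ _ h.choose_spec hx
  refine ⟨U, ?_, hU⟩
  refine (locallyFinite_of_finite A).continuousOn_iUnion hA ?_
  intro i
  exact (hF i).congr (hU i)

theorem aux_tietze {X Y : Type} [TopologicalSpace X] [NormalSpace X]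
    [TopologicalSpace Y] [TietzeExtension.{0, 0} Y] {A : Set X} (hA : IsClosed A) (f : X → Y)
    (hf : ContinuousOn f A) : ∃ g : X → Y, Continuous g ∧ ∀ x ∈ A, g x = f x := by
  obtain ⟨g, hg⟩ := ContinuousMap.exists_restrict_eq hA
    (⟨A.domRestrict f, continuousOn_iff_continuous_domRestrict.1 hf⟩ : C(A, Y))
  refine ⟨g, g.continuous, fun x hx => ?_⟩
  exact congrArg (fun h : C(A, Y) => h ⟨x, hx⟩) hg

/-- Nonvanishing extension: maps from a subset of a 3-dimensional space into `ℝ⁴ ∖ 0`. -/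
theorem aux_nonvanish (A : Set (ℝ × ℂ)) (hA : IsCompact A) (H : ℝ × ℂ → ℂ × ℂ)
    (hH : Continuous H) (hne : ∀ x ∈ A, H x ≠ 0) :
    ∃ H' : ℝ × ℂ → ℂ × ℂ, Continuous H' ∧ (∀ x ∈ A, H' x = H x) ∧ ∀ x, H' x ≠ 0 := by
  obtain ⟨ε, hε, hεA⟩ : ∃ ε : ℝ, 0 < ε ∧ ∀ x ∈ A, ε ≤ ‖H x‖ := by
    rcases A.eq_empty_or_nonempty with rfl | hAn
    · exact ⟨1, one_pos, by simp⟩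
    · obtain ⟨x, hx, hmin⟩ := hA.exists_isMinOn hAn hH.norm.continuousOn
      exact ⟨‖H x‖, norm_pos_iff.2 (hne x hx), fun y hy => hmin hy⟩
  obtain ⟨G, hG, hGd, -⟩ := hH.exists_contDiff_approx 1 (ε := fun _ => ε / 8)
    continuous_const (fun _ => by positivity)
  have hfin : Module.finrank ℝ (ℝ × ℂ) < Module.finrank ℝ (ℂ × ℂ) := by
    simp [Complex.finrank_real_complex]
  have hdense := hG.dense_compl_range_of_finrank_lt_finrank hfin
  obtain ⟨v, hv, hvd⟩ := hdense.exists_dist_lt (0 : ℂ × ℂ) (ε := ε / 8) (by positivity)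
  have hvn : ‖v‖ < ε / 8 := by simpa [dist_eq_norm] using hvd
  -- the cut-off function
  let χ : ℝ → ℝ := fun r => max 0 (min 1 (2 - 2 * r / ε))
  have hχ : Continuous χ := by
    dsimp only [χ]; fun_prop
  have hχ0 : ∀ r, 0 ≤ χ r := fun r => le_max_left _ _
  have hχ1 : ∀ r, χ r ≤ 1 := fun r => max_le zero_le_one (min_le_left _ _)
  have hclose : ∀ x, ‖G x - v - H x‖ ≤ ε / 4 := by
    intro x
    have h1 : ‖G x - H x‖ < ε / 8 := by simpa [dist_eq_norm] using hGd x
    have : G x - v - H x = (G x - H x) - v := by abel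
    rw [this]
    have := norm_sub_le (G x - H x) v
    linarith
  refine ⟨fun x => H x + χ ‖H x‖ • (G x - v - H x), ?_, ?_, ?_⟩
  · have := hG.continuous
    fun_prop
  · intro x hx
    have h := hεA x hx
    have : χ ‖H x‖ = 0 := by
      have h2 : 2 - 2 * ‖H x‖ / ε ≤ 0 := by
        rw [sub_nonpos, le_div_iff₀ hε]; linarith
      exact max_eq_left ((min_le_right _ _).trans h2)
    simp [this]
  · intro x h0
    by_cases hx : ‖H x‖ ≤ ε / 2
    · have : χ ‖H x‖ = 1 := by
        have h2 : 1 ≤ 2 - 2 * ‖H x‖ / ε := by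
          have : 2 * ‖H x‖ / ε ≤ 1 := by rw [div_le_one hε]; linarith
          linarith
        simp only [χ]
        rw [min_eq_left h2]; simp
      simp only [this, one_smul] at h0
      apply hv
      refine ⟨x, ?_⟩
      have h3 : G x - v = 0 := by rw [← h0]; abel
      exact sub_eq_zero.1 h3
    · push Not at hx
      have h3 : ‖H x‖ = ‖χ ‖H x‖ • (G x - v - H x)‖ :=
        (congrArg norm (eq_neg_of_add_eq_zero_left h0)).trans (norm_neg _)
      rw [norm_smul, Real.norm_of_nonneg (hχ0 _)] at h3
      have h4 := mul_le_mul (hχ1 ‖H x‖) (hclose x) (norm_nonneg _) zero_le_one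
      linarith

/-- Discretised contraction of a map on a compact convex set. -/
theorem aux_chain {E X : Type*} [NormedAddCommGroup E] [NormedSpace ℝ E] [MetricSpace X]
    {K : Set E} (hK : IsCompact K) (hc : Convex ℝ K) (x0 : E) (hx0 : x0 ∈ K) (f : E → X)
    (hf : ContinuousOn f K) (δ : ℝ) (hδ : 0 < δ) :
    ∃ (N : ℕ) (F : ℕ → E → X), (∀ x ∈ K, F 0 x = f x0) ∧ (∀ x ∈ K, F N x = f x) ∧
      (∀ i ≤ N, ContinuousOn (F i) K) ∧ (∀ i ≤ N, ∀ x ∈ K, ∃ y ∈ K, F i x = f y) ∧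
      (∀ i < N, ∀ x ∈ K, dist (F (i + 1) x) (F i x) < δ) := by
  have hu := hK.uniformContinuousOn_of_continuous hf
  rw [Metric.uniformContinuousOn_iff] at hu
  obtain ⟨η, hη, hu⟩ := hu δ hδ
  obtain ⟨M, hM⟩ := hK.isBounded.exists_norm_le
  have hM0 : 0 ≤ M := (norm_nonneg x0).trans (hM x0 hx0)
  obtain ⟨N, hN⟩ := exists_nat_gt ((2 * M + 1) / η)
  have hNpos : (0 : ℝ) < N := lt_of_le_of_lt (by positivity) hN
  have hmem : ∀ i ≤ N, ∀ x ∈ K, x0 + ((i : ℝ) / N) • (x - x0) ∈ K := by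
    intro i hi x hx
    have h1 : (i : ℝ) / N ≤ 1 := by
      rw [div_le_one hNpos]; exact_mod_cast hi
    have h0 : 0 ≤ (i : ℝ) / N := by positivity
    have := hc hx0 hx (sub_nonneg.2 h1) h0 (by ring)
    convert this using 1
    module
  refine ⟨N, fun i x => f (x0 + ((i : ℝ) / N) • (x - x0)), ?_, ?_, ?_, ?_, ?_⟩
  · intro x _; simp
  · intro x _; simp [div_self hNpos.ne']
  · intro i hi
    exact hf.comp (by fun_prop) (fun x hx => hmem i hi x hx)
  · intro i hi x hx
    exact ⟨_, hmem i hi x hx, rfl⟩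
  · intro i hi x hx
    apply hu _ (hmem (i + 1) hi x hx) _ (hmem i hi.le x hx)
    rw [dist_eq_norm]
    have : x0 + (((i + 1 : ℕ) : ℝ) / N) • (x - x0) - (x0 + ((i : ℝ) / N) • (x - x0)) =
        ((1 : ℝ) / N) • (x - x0) := by
      push_cast
      rw [add_div]
      module
    rw [this, norm_smul, Real.norm_of_nonneg (by positivity)]
    have h2 : ‖x - x0‖ ≤ 2 * M := by
      have := norm_sub_le x x0
      have := hM x hx
      have := hM x0 hx0
      linarith
    rw [div_lt_iff₀ hη] at hN
    rw [one_div, inv_mul_lt_iff₀ hNpos]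
    linarith

/-- Continuous logarithm on a compact convex set. -/
theorem aux_log {E : Type*} [NormedAddCommGroup E] [NormedSpace ℝ E]
    {K : Set E} (hK : IsCompact K) (hc : Convex ℝ K) (f : E → ℂ)
    (hf : ContinuousOn f K) (hne : ∀ x ∈ K, f x ≠ 0) :
    ∃ L : E → ℂ, ContinuousOn L K ∧ ∀ x ∈ K, f x = Complex.exp (L x) := by
  rcases K.eq_empty_or_nonempty with rfl | ⟨x0, hx0⟩
  · exact ⟨0, by simp, by simp⟩
  obtain ⟨y, hy, hmin⟩ := hK.exists_isMinOn ⟨x0, hx0⟩ hf.norm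
  have hmp : 0 < ‖f y‖ := norm_pos_iff.2 (hne y hy)
  obtain ⟨N, F, hF0, hFN, hFc, hFm, hFd⟩ := aux_chain hK hc x0 hx0 f hf ‖f y‖ hmp
  have hFne : ∀ i ≤ N, ∀ x ∈ K, F i x ≠ 0 := by
    intro i hi x hx
    obtain ⟨w, hw, he⟩ := hFm i hi x hx
    rw [he]; exact hne w hw
  have key : ∀ i ≤ N, ∃ L : E → ℂ, ContinuousOn L K ∧ ∀ x ∈ K, F i x = Complex.exp (L x) := by
    intro i
    induction i with
    | zero =>
      intro _
      refine ⟨fun _ => Complex.log (f x0), continuousOn_const, fun x hx => ?_⟩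
      rw [hF0 x hx, Complex.exp_log (hne x0 hx0)]
    | succ i ih =>
      intro hi
      obtain ⟨L, hL, hLe⟩ := ih (by omega)
      refine ⟨fun x => L x + Complex.log (F (i + 1) x / F i x), ?_, ?_⟩
      · refine hL.add (ContinuousOn.clog ?_ ?_)
        · exact (hFc (i + 1) hi).div (hFc i (by omega)) (hFne i (by omega))
        · intro x hx
          have h0 := hFne i (by omega) x hx
          have hd := hFd i (by omega) x hx
          obtain ⟨w, hw, he⟩ := hFm i (by omega) x hx
          have hle : ‖f y‖ ≤ ‖F i x‖ := by rw [he]; exact hmin hw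
          have h1 : ‖F (i + 1) x / F i x - 1‖ < 1 := by
            rw [div_sub_one h0, norm_div, div_lt_one (norm_pos_iff.2 h0), ← dist_eq_norm]
            exact lt_of_lt_of_le hd hle
          have := Complex.mem_slitPlane_of_norm_lt_one h1
          simpa using this
      · intro x hx
        rw [Complex.exp_add, ← hLe x hx, Complex.exp_log, mul_div_cancel₀]
        · exact hFne i (by omega) x hx
        · exact div_ne_zero (hFne (i + 1) hi x hx) (hFne i (by omega) x hx)
  obtain ⟨L, hL, hLe⟩ := key N le_rfl
  exact ⟨L, hL, fun x hx => by rw [← hFN x hx, hLe x hx]⟩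

/-! ### Winding numbers on the circle -/

/-- `f` restricted to the unit circle is nonvanishing with winding number `k`. -/
def HW (f : ℂ → ℂ) (k : ℤ) : Prop :=
  ∃ g : ℂ → ℂ, ContinuousOn g (Metric.sphere 0 1) ∧
    ∀ ω ∈ Metric.sphere (0 : ℂ) 1, f ω = ω ^ k * Complex.exp (g ω)

theorem aux_sphere_ne {ω : ℂ} (h : ω ∈ Metric.sphere (0 : ℂ) 1) : ω ≠ 0 := by
  rintro rfl
  simp at h

theorem aux_exp_mem (t : ℝ) : Complex.exp (t * Complex.I) ∈ Metric.sphere (0 : ℂ) 1 := by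
  simp [Complex.norm_exp_ofReal_mul_I]

theorem aux_exp_arg {ω : ℂ} (h : ω ∈ Metric.sphere (0 : ℂ) 1) :
    Complex.exp (Complex.arg ω * Complex.I) = ω := by
  have := Complex.norm_mul_exp_arg_mul_I ω
  rw [mem_sphere_zero_iff_norm] at h
  rw [h] at this
  simpa using this

theorem HW.congr {f f' : ℂ → ℂ} {k : ℤ} (h : HW f k)
    (he : ∀ ω ∈ Metric.sphere (0 : ℂ) 1, f' ω = f ω) : HW f' k := by
  obtain ⟨g, hg, h⟩ := h
  exact ⟨g, hg, fun ω hω => by rw [he ω hω, h ω hω]⟩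

theorem HW.mul {f f' : ℂ → ℂ} {k k' : ℤ} (h : HW f k) (h' : HW f' k') :
    HW (fun ω => f ω * f' ω) (k + k') := by
  obtain ⟨g, hg, h⟩ := h
  obtain ⟨g', hg', h'⟩ := h'
  refine ⟨fun ω => g ω + g' ω, hg.add hg', fun ω hω => ?_⟩
  simp only []
  rw [h ω hω, h' ω hω, zpow_add₀ (aux_sphere_ne hω), Complex.exp_add]
  ring

theorem HW.zpow {f : ℂ → ℂ} {k : ℤ} (h : HW f k) (m : ℤ) :
    HW (fun ω => f ω ^ m) (k * m) := by
  obtain ⟨g, hg, h⟩ := h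
  refine ⟨fun ω => m * g ω, by fun_prop, fun ω hω => ?_⟩
  simp only []
  rw [h ω hω, mul_zpow, _root_.zpow_mul, Complex.exp_int_mul]

theorem HW.prod {ι : Type*} (s : Finset ι) (f : ι → ℂ → ℂ) (k : ι → ℤ)
    (h : ∀ i ∈ s, HW (f i) (k i)) : HW (fun ω => ∏ i ∈ s, f i ω) (∑ i ∈ s, k i) := by
  classical
  induction s using Finset.induction_on with
  | empty => exact ⟨fun _ => 0, continuousOn_const, by simp⟩
  | insert a s ha ih =>
    have h1 := h a (Finset.mem_insert_self a s)
    have h2 := ih (fun i hi => h i (Finset.mem_insert_of_mem hi))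
    simp only [Finset.prod_insert ha, Finset.sum_insert ha]
    exact h1.mul h2

theorem aux_circle_cont {Z : Type*} [TopologicalSpace Z] (G : ℂ → Z)
    (hG : ContinuousOn (fun t : ℝ => G (Complex.exp (t * Complex.I)))
      (Icc (-Real.pi) Real.pi)) : ContinuousOn G (Metric.sphere 0 1) := by
  refine aux_quot isCompact_Icc (fun t : ℝ => Complex.exp (t * Complex.I))
    (by fun_prop) ?_ (fun t _ => aux_exp_mem t) G hG
  intro ω hω
  exact ⟨Complex.arg ω, ⟨(Complex.neg_pi_lt_arg ω).le, Complex.arg_le_pi ω⟩, aux_exp_arg hω⟩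

/-- A function of the argument is compatible with the exponential if periodic. -/
theorem aux_arg_exp {Z : Type*} (F : ℝ → Z) (hF : F (-Real.pi) = F Real.pi) {t : ℝ}
    (ht : t ∈ Icc (-Real.pi) Real.pi) : F (Complex.arg (Complex.exp (t * Complex.I))) = F t := by
  rcases ht.1.lt_or_eq with h | h
  · rw [Complex.arg_exp_mul_I, (toIocMod_eq_self Real.two_pi_pos).2]
    constructor <;> [exact h; linarith [ht.2]]
  · rw [← h]
    have : Complex.exp ((-Real.pi : ℝ) * Complex.I) = -1 := by
      rw [Complex.ofReal_neg, neg_mul, Complex.exp_neg, Complex.exp_pi_mul_I]; norm_num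
    rw [this, Complex.arg_neg_one, hF]

theorem HW_exists (f : ℂ → ℂ) (hf : ContinuousOn f (Metric.sphere 0 1))
    (hne : ∀ ω ∈ Metric.sphere (0 : ℂ) 1, f ω ≠ 0) : ∃ k, HW f k := by
  obtain ⟨L, hL, hLe⟩ := aux_log (isCompact_Icc (a := -Real.pi) (b := Real.pi))
    (convex_Icc _ _) (fun t : ℝ => f (Complex.exp (t * Complex.I)))
    (hf.comp (by fun_prop) (fun t _ => aux_exp_mem t)) (fun t _ => hne _ (aux_exp_mem t))
  have hpi := Real.pi_pos
  have h1 := hLe (-Real.pi) ⟨le_rfl, by linarith⟩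
  have h2 := hLe Real.pi ⟨by linarith, le_rfl⟩
  have h3 : Complex.exp ((-Real.pi : ℝ) * Complex.I) = Complex.exp ((Real.pi : ℝ) * Complex.I) := by
    rw [Complex.ofReal_neg, neg_mul, Complex.exp_neg, Complex.exp_pi_mul_I]; norm_num
  rw [h3, h2, Complex.exp_eq_exp_iff_exists_int] at h1
  obtain ⟨k, hk⟩ := h1
  let F : ℝ → ℂ := fun t => L t - k * (t * Complex.I)
  have hF : F (-Real.pi) = F Real.pi := by
    simp only [F]
    rw [hk]; push_cast; ring
  refine ⟨k, fun ω => F (Complex.arg ω), ?_, ?_⟩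
  · apply aux_circle_cont
    have : ContinuousOn F (Icc (-Real.pi) Real.pi) := by
      simp only [F]; fun_prop
    exact this.congr (fun t ht => aux_arg_exp F hF ht)
  · intro ω hω
    have h4 := hLe (Complex.arg ω) ⟨(Complex.neg_pi_lt_arg ω).le, Complex.arg_le_pi ω⟩
    rw [aux_exp_arg hω] at h4
    rw [h4]
    simp only [F]
    rw [Complex.exp_sub, Complex.exp_int_mul, aux_exp_arg hω]
    field_simp [zpow_ne_zero k (aux_sphere_ne hω)]

theorem HW_zero {f : ℂ → ℂ} {k : ℤ} (h : HW f k) (h0 : HW f 0) : k = 0 := by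
  obtain ⟨g, hg, h⟩ := h
  obtain ⟨g', hg', h'⟩ := h0
  let D : ℝ → ℂ := fun t => (k * (t * Complex.I) + g (Complex.exp (t * Complex.I))
    - g' (Complex.exp (t * Complex.I))) / (2 * Real.pi * Complex.I)
  have hq : Continuous (fun t : ℝ => Complex.exp (t * Complex.I)) := by fun_prop
  have hD : Continuous D := by
    have e1 : Continuous (fun t : ℝ => g (Complex.exp (t * Complex.I))) :=
      hg.comp_continuous hq aux_exp_mem
    have e2 : Continuous (fun t : ℝ => g' (Complex.exp (t * Complex.I))) :=
      hg'.comp_continuous hq aux_exp_mem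
    exact (((continuous_const.mul (by fun_prop)).add e1).sub e2).div_const _
  have hpi : (2 * Real.pi * Complex.I : ℂ) ≠ 0 := Complex.two_pi_I_ne_zero
  have h_intv : ∀ t, ∃ m : ℤ, D t = m := by
    intro t
    have e1 := h _ (aux_exp_mem t)
    rw [h' _ (aux_exp_mem t), zpow_zero, one_mul, ← Complex.exp_int_mul, ← Complex.exp_add,
      eq_comm, Complex.exp_eq_exp_iff_exists_int] at e1
    obtain ⟨m, hm⟩ := e1
    refine ⟨m, ?_⟩
    simp only [D]
    rw [hm]; field_simp; ring
  have hconst : ∀ t, (D t).re = (D 0).re := by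
    intro t
    have hc : Continuous fun t => (D t).re := Complex.continuous_re.comp hD
    choose m hm using h_intv
    have hm' : ∀ t, (D t).re = m t := fun t => by rw [hm]; simp
    have hmc : Continuous m := by
      have : Continuous (fun t => ((m t : ℤ) : ℝ)) := by simpa [hm'] using hc
      exact Int.isClosedEmbedding_coe_real.isEmbedding.continuous_iff.2 this
    have := PreconnectedSpace.constant (inferInstance : PreconnectedSpace ℝ) hmc (x := t) (y := 0)
    rw [hm', hm', this]
  have := hconst (2 * Real.pi)
  have e3 : Complex.exp ((2 * Real.pi : ℝ) * Complex.I) = Complex.exp ((0 : ℝ) * Complex.I) := by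
    simp [Complex.exp_two_pi_mul_I]
  have e4 : D (2 * Real.pi) = k + D 0 := by
    simp only [D]
    rw [e3]; push_cast; field_simp; ring
  rw [e4] at this
  simp at this
  exact_mod_cast this

theorem HW.transfer {f : ℂ → ℂ} {k : ℤ} (h : HW f k) (θ : ℝ → ℝ) (hθ : Continuous θ)
    (hp : ∀ φ, θ (φ + 2 * Real.pi) = θ φ + 2 * Real.pi) :
    HW (fun ω => f (Complex.exp (θ (Complex.arg ω) * Complex.I))) k := by
  obtain ⟨g, hg, h⟩ := h
  let F : ℝ → ℂ := fun t => k * ((θ t - t : ℝ) * Complex.I) +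
    g (Complex.exp (θ t * Complex.I))
  have hFc : Continuous F := by
    have e1 : Continuous (fun t : ℝ => g (Complex.exp (θ t * Complex.I))) :=
      hg.comp_continuous (by fun_prop) (fun t => aux_exp_mem _)
    exact (continuous_const.mul (by fun_prop)).add e1
  have hF : F (-Real.pi) = F Real.pi := by
    have e := hp (-Real.pi)
    have e' : -Real.pi + 2 * Real.pi = Real.pi := by ring
    rw [e'] at e
    simp only [F]
    rw [e]
    have e2 : Complex.exp ((θ (-Real.pi) + 2 * Real.pi : ℝ) * Complex.I) =
        Complex.exp (θ (-Real.pi) * Complex.I) := by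
      push_cast
      rw [add_mul, Complex.exp_add, Complex.exp_two_pi_mul_I, mul_one]
    rw [e2]; push_cast; ring
  refine ⟨fun ω => F (Complex.arg ω), ?_, ?_⟩
  · apply aux_circle_cont
    exact hFc.continuousOn.congr (fun t ht => aux_arg_exp F hF ht)
  · intro ω hω
    simp only []
    rw [h _ (aux_exp_mem _)]
    simp only [F]
    rw [Complex.exp_add, ← mul_assoc]
    congr 1
    rw [Complex.exp_int_mul]
    have e : Complex.exp (θ (Complex.arg ω) * Complex.I) =
        ω * Complex.exp ((θ (Complex.arg ω) - Complex.arg ω : ℝ) * Complex.I) := by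
      nth_rewrite 2 [← aux_exp_arg hω]
      rw [← Complex.exp_add]
      congr 1
      push_cast; ring
    rw [← mul_zpow, ← e]

theorem HW_exp (L : ℂ → ℂ) (hL : ContinuousOn L (Metric.sphere 0 1)) (f : ℂ → ℂ)
    (h : ∀ ω ∈ Metric.sphere (0 : ℂ) 1, f ω = Complex.exp (L ω)) : HW f 0 :=
  ⟨L, hL, fun ω hω => by simp [h ω hω]⟩

theorem HW_pos (r : ℂ → ℝ) (hr : ContinuousOn r (Metric.sphere 0 1))
    (hp : ∀ ω ∈ Metric.sphere (0 : ℂ) 1, 0 < r ω) : HW (fun ω => (r ω : ℂ)) 0 := by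
  refine HW_exp (fun ω => (Real.log (r ω) : ℂ)) ?_ _ ?_
  · exact Complex.continuous_ofReal.comp_continuousOn (hr.log (fun ω h => (hp ω h).ne'))
  · intro ω hω
    rw [← Complex.ofReal_exp, Real.exp_log (hp ω hω)]

theorem HW_id : HW (fun ω => ω) 1 := ⟨fun _ => 0, continuousOn_const, by simp⟩

theorem HW_lin (a b : ℂ) (hdet : a.re * b.im - a.im * b.re < 0) :
    HW (fun ω => ω.re * a + ω.im * b) (-1) := by
  let α : ℂ := (a - Complex.I * b) / 2
  let β : ℂ := (a + Complex.I * b) / 2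
  have hlt : ‖α‖ < ‖β‖ := by
    have : Complex.normSq α < Complex.normSq β := by
      simp only [α, β, Complex.normSq_apply]
      simp
      nlinarith
    rw [Complex.normSq_eq_norm_sq, Complex.normSq_eq_norm_sq] at this
    exact lt_of_pow_lt_pow_left₀ 2 (norm_nonneg _) this
  have hβ : β ≠ 0 := norm_pos_iff.1 (lt_of_le_of_lt (norm_nonneg _) hlt)
  have hs : ∀ ω ∈ Metric.sphere (0 : ℂ) 1, ‖α / β * ω ^ 2‖ < 1 := by
    intro ω hω
    rw [mem_sphere_zero_iff_norm] at hω
    rw [norm_mul, norm_pow, hω, norm_div]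
    simpa using (div_lt_one (norm_pos_iff.2 hβ)).2 hlt
  refine ⟨fun ω => Complex.log β + Complex.log (1 + α / β * ω ^ 2), ?_, ?_⟩
  · refine continuousOn_const.add (ContinuousOn.clog (by fun_prop) ?_)
    intro ω hω
    exact Complex.mem_slitPlane_of_norm_lt_one (hs ω hω)
  · intro ω hω
    have h0 := aux_sphere_ne hω
    simp only []
    rw [Complex.exp_add, Complex.exp_log hβ, Complex.exp_log
      (Complex.slitPlane_ne_zero (Complex.mem_slitPlane_of_norm_lt_one (hs ω hω)))]
    have e : β * (1 + α / β * ω ^ 2) = β + α * ω ^ 2 := by field_simp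
    rw [e, _root_.zpow_neg_one, eq_inv_mul_iff_mul_eq₀ h0]
    rw [mem_sphere_zero_iff_norm] at hω
    have hn : ω.re * ω.re + ω.im * ω.im = 1 := by
      rw [← Complex.normSq_apply, Complex.normSq_eq_norm_sq, hω]; norm_num
    apply Complex.ext
    · simp [α, β, pow_two]
      linear_combination ((a.re - b.im) / 2) * hn
    · simp [α, β, pow_two]
      linear_combination ((a.im + b.re) / 2) * hn

/-! ### Spinors and the Hopf map -/

/-- The horizontal part of a vector as a complex number. -/
def zc (x : V3) : ℂ := (x 0 : ℂ) + (x 1 : ℂ) * Complex.I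

/-- The north pole. -/
def npole : V3 := ![0, 0, 1]

theorem zc_re (x : V3) : (zc x).re = x 0 := by simp [zc]
theorem zc_im (x : V3) : (zc x).im = x 1 := by simp [zc]

theorem zc_cont : Continuous zc := by unfold zc; fun_prop

theorem mem_sphereS (x : V3) : x ∈ sphereS ↔ x 0 ^ 2 + x 1 ^ 2 + x 2 ^ 2 = 1 := by
  simp only [sphereS, Set.mem_ofPred_eq, dotProduct, Fin.sum_univ_three]
  constructor <;> intro h <;> linarith [h]

theorem sphereS_closed : IsClosed sphereS := by
  have : sphereS = {x : V3 | x 0 ^ 2 + x 1 ^ 2 + x 2 ^ 2 = 1} := by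
    ext x; exact mem_sphereS x
  rw [this]
  exact isClosed_eq (by fun_prop) continuous_const

theorem zc_norm_sq (x : V3) : ‖zc x‖ ^ 2 = x 0 ^ 2 + x 1 ^ 2 := by
  rw [← Complex.normSq_eq_norm_sq, Complex.normSq_apply, zc_re, zc_im]; ring

theorem zc_norm (x : V3) : ‖zc x‖ = Real.sqrt (x 0 ^ 2 + x 1 ^ 2) := by
  rw [← zc_norm_sq, Real.sqrt_sq (norm_nonneg _)]

theorem zc_mem_ball {x : V3} (h : x ∈ sphereS) : zc x ∈ Metric.closedBall (0 : ℂ) 1 := by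
  rw [mem_closedBall_zero_iff]
  rw [mem_sphereS] at h
  have := zc_norm_sq x
  nlinarith [norm_nonneg (zc x), sq_nonneg (x 2)]

/-- The Hopf map. -/
def hopf (p : ℂ × ℂ) : V3 :=
  ![2 * (p.1.re * p.2.re + p.1.im * p.2.im) / (Complex.normSq p.1 + Complex.normSq p.2),
    2 * (p.1.im * p.2.re - p.1.re * p.2.im) / (Complex.normSq p.1 + Complex.normSq p.2),
    (Complex.normSq p.2 - Complex.normSq p.1) / (Complex.normSq p.1 + Complex.normSq p.2)]

theorem hopf_den {p : ℂ × ℂ} (h : p ≠ 0) : 0 < Complex.normSq p.1 + Complex.normSq p.2 := by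
  by_cases h1 : p.1 = 0
  · have h2 : p.2 ≠ 0 := fun h2 => h (Prod.ext h1 h2)
    have := Complex.normSq_pos.2 h2
    have := Complex.normSq_nonneg p.1
    linarith
  · have := Complex.normSq_pos.2 h1
    have := Complex.normSq_nonneg p.2
    linarith

theorem hopf_cont : ContinuousOn hopf {p | p ≠ 0} := by
  have h1 : Continuous fun p : ℂ × ℂ => Complex.normSq p.1 + Complex.normSq p.2 := by
    have := Complex.continuous_normSq
    fun_prop
  have h2 : Continuous fun p : ℂ × ℂ => Complex.normSq p.2 - Complex.normSq p.1 := by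
    have := Complex.continuous_normSq
    fun_prop
  refine continuousOn_pi.2 fun i => ?_
  fin_cases i
  · exact ContinuousOn.div (Continuous.continuousOn (by fun_prop)) h1.continuousOn
      (fun p hp => (hopf_den hp).ne')
  · exact ContinuousOn.div (Continuous.continuousOn (by fun_prop)) h1.continuousOn
      (fun p hp => (hopf_den hp).ne')
  · exact ContinuousOn.div h2.continuousOn h1.continuousOn
      (fun p hp => (hopf_den hp).ne')

theorem hopf_mem {p : ℂ × ℂ} (h : p ≠ 0) : hopf p ∈ sphereS := by
  have := hopf_den h
  rw [mem_sphereS]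
  simp only [hopf, Matrix.cons_val_zero, Matrix.cons_val_one, Matrix.cons_val]
  rw [div_pow, div_pow, div_pow, ← add_div, ← add_div, div_eq_one_iff_eq (by positivity)]
  simp only [Complex.normSq_apply]
  ring

theorem hopf_smul (c : ℂ) (hc : c ≠ 0) (p : ℂ × ℂ) : hopf (c * p.1, c * p.2) = hopf p := by
  have hc' : Complex.normSq c ≠ 0 := (Complex.normSq_pos.2 hc).ne'
  have e : Complex.normSq (c * p.1) + Complex.normSq (c * p.2) =
    Complex.normSq c * (Complex.normSq p.1 + Complex.normSq p.2) := by
    rw [Complex.normSq_mul, Complex.normSq_mul]; ring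
  ext i
  fin_cases i
  · simp only [hopf, Fin.zero_eta, Matrix.cons_val_zero]
    rw [e, ← mul_div_mul_left _ (Complex.normSq p.1 + Complex.normSq p.2) hc']
    congr 1
    simp [Complex.normSq_apply]; ring
  · simp only [hopf, Fin.mk_one, Matrix.cons_val_one, Matrix.cons_val_zero]
    rw [e, ← mul_div_mul_left _ (Complex.normSq p.1 + Complex.normSq p.2) hc']
    congr 1
    simp [Complex.normSq_apply]; ring
  · simp only [hopf, Fin.reduceFinMk, Matrix.cons_val]
    rw [e, ← mul_div_mul_left _ (Complex.normSq p.1 + Complex.normSq p.2) hc']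
    congr 1
    rw [Complex.normSq_mul, Complex.normSq_mul]; ring

/-- `p` is a spinor over `n`. -/
def LiftS (n : V3) (p : ℂ × ℂ) : Prop :=
  p ≠ 0 ∧ (1 + n 2 : ℝ) * p.1 = zc n * p.2 ∧ (starRingEnd ℂ) (zc n) * p.1 = (1 - n 2 : ℝ) * p.2

theorem LiftS.hopf {n : V3} {p : ℂ × ℂ} (h : LiftS n p) : hopf p = n := by
  obtain ⟨h0, h1, h2⟩ := h
  have hd := hopf_den h0
  have a1 := congrArg Complex.re h1
  have a2 := congrArg Complex.im h1
  have a3 := congrArg Complex.re h2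
  have a4 := congrArg Complex.im h2
  simp [zc] at a1 a2 a3 a4
  ext i
  fin_cases i
  · simp only [_root_.hopf, Fin.zero_eta, Matrix.cons_val_zero]
    rw [div_eq_iff hd.ne']
    simp only [Complex.normSq_apply]
    linear_combination p.2.re * a1 + p.2.im * a2 - p.1.re * a3 - p.1.im * a4
  · simp only [_root_.hopf, Fin.mk_one, Matrix.cons_val_one, Matrix.cons_val_zero]
    rw [div_eq_iff hd.ne']
    simp only [Complex.normSq_apply]
    linear_combination p.2.re * a2 - p.2.im * a1 - p.1.im * a3 + p.1.re * a4
  · simp only [_root_.hopf, Fin.reduceFinMk, Matrix.cons_val]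
    rw [div_eq_iff hd.ne']
    simp only [Complex.normSq_apply]
    linear_combination -p.1.re * a1 - p.1.im * a2 - p.2.re * a3 - p.2.im * a4

theorem LiftS.fst_ne {n : V3} {p : ℂ × ℂ} (h : LiftS n p) (hn : n ≠ npole) : p.1 ≠ 0 := by
  intro h0
  apply hn
  have h2 : p.2 ≠ 0 := fun h2 => h.1 (Prod.ext h0 h2)
  have e := h.2
  rw [h0] at e
  simp only [mul_zero] at e
  have e1 : zc n = 0 := by
    rcases mul_eq_zero.1 e.1.symm with h | h
    · exact h
    · exact absurd h h2
  have e2 : ((1 - n 2 : ℝ) : ℂ) = 0 := by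
    rcases mul_eq_zero.1 e.2.symm with h | h
    · exact h
    · exact absurd h h2
  have e3 : 1 - n 2 = 0 := by exact_mod_cast e2
  have e4 := zc_re n
  have e5 := zc_im n
  rw [e1] at e4 e5
  ext i
  fin_cases i
  · simpa [npole] using e4.symm
  · simpa [npole] using e5.symm
  · simp [npole]; linarith

/-- Projection on the spin-line of `m`. -/
def projS (m : V3) (p : ℂ × ℂ) : ℂ × ℂ :=
  ((1 - m 2 : ℝ) * p.1 + zc m * p.2, (starRingEnd ℂ) (zc m) * p.1 + (1 + m 2 : ℝ) * p.2)

theorem LiftS.proj {n m : V3} {p : ℂ × ℂ} (h : LiftS n p) (hm : m ∈ sphereS) (hne : m ≠ -n) :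
    LiftS m (projS m p) := by
  rw [mem_sphereS] at hm
  have hz : zc m * (starRingEnd ℂ) (zc m) = (1 - m 2 : ℝ) * (1 + m 2 : ℝ) := by
    rw [Complex.mul_conj, Complex.normSq_eq_norm_sq, zc_norm_sq, ← Complex.ofReal_mul]
    congr 1; linarith
  refine ⟨?_, ?_, ?_⟩
  · intro h0
    apply hne
    have e1 : (1 - m 2 : ℝ) * p.1 + zc m * p.2 = 0 := congrArg Prod.fst h0
    have e2 : (starRingEnd ℂ) (zc m) * p.1 + (1 + m 2 : ℝ) * p.2 = 0 := congrArg Prod.snd h0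
    have hneg : zc (-m) = - zc m := by simp [zc]; ring
    have h3 : LiftS (-m) p := by
      refine ⟨h.1, ?_, ?_⟩
      · rw [hneg]
        simp only [Pi.neg_apply]
        push_cast at e1 ⊢
        linear_combination e1
      · rw [hneg]
        simp only [Pi.neg_apply]
        push_cast at e2 ⊢
        rw [map_neg]
        linear_combination -e2
    rw [← h.hopf, h3.hopf, neg_neg]
  · simp only [projS]
    linear_combination (-p.1) * hz
  · simp only [projS]
    linear_combination (p.2) * hz

theorem LiftS_exists (n : V3) (hn : n ∈ sphereS) : ∃ p, LiftS n p := by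
  rw [mem_sphereS] at hn
  have hz : zc n * (starRingEnd ℂ) (zc n) = (1 - n 2 : ℝ) * (1 + n 2 : ℝ) := by
    rw [Complex.mul_conj, Complex.normSq_eq_norm_sq, zc_norm_sq, ← Complex.ofReal_mul]
    congr 1; linarith
  by_cases h : n 2 = -1
  · refine ⟨(1, 0), by simp, ?_, ?_⟩
    · simp [h]
    · have h0 : n 0 = 0 := by nlinarith [sq_nonneg (n 0), sq_nonneg (n 1)]
      have h1 : n 1 = 0 := by nlinarith [sq_nonneg (n 0), sq_nonneg (n 1)]
      simp [zc, h0, h1]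
  · refine ⟨(zc n, (1 + n 2 : ℝ)), ?_, ?_, ?_⟩
    · intro h0
      have : ((1 + n 2 : ℝ) : ℂ) = 0 := congrArg Prod.snd h0
      have : 1 + n 2 = 0 := by exact_mod_cast this
      exact h (by linarith)
    · simp only []; ring
    · simp only []; rw [mul_comm, hz]

theorem projS_cont : Continuous fun q : V3 × (ℂ × ℂ) => projS q.1 q.2 := by
  have a : Continuous fun q : V3 × (ℂ × ℂ) => q.1 2 := (continuous_apply 2).comp continuous_fst
  have a1 : Continuous fun q : V3 × (ℂ × ℂ) => ((1 - q.1 2 : ℝ) : ℂ) :=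
    Complex.continuous_ofReal.comp (continuous_const.sub a)
  have a2 : Continuous fun q : V3 × (ℂ × ℂ) => ((1 + q.1 2 : ℝ) : ℂ) :=
    Complex.continuous_ofReal.comp (continuous_const.add a)
  have z : Continuous fun q : V3 × (ℂ × ℂ) => zc q.1 := zc_cont.comp continuous_fst
  have z' : Continuous fun q : V3 × (ℂ × ℂ) => (starRingEnd ℂ) (zc q.1) :=
    Complex.continuous_conj.comp z
  have p1 : Continuous fun q : V3 × (ℂ × ℂ) => q.2.1 := continuous_fst.comp continuous_snd
  have p2 : Continuous fun q : V3 × (ℂ × ℂ) => q.2.2 := continuous_snd.comp continuous_snd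
  exact ((a1.mul p1).add (z.mul p2)).prodMk ((z'.mul p1).add (a2.mul p2))

theorem aux_projS {K : Set V3} {n : V3 → V3} {Ψ : V3 → ℂ × ℂ} (h1 : ContinuousOn n K)
    (h2 : ContinuousOn Ψ K) : ContinuousOn (fun x => projS (n x) (Ψ x)) K := by
  have h3 : ContinuousOn (fun x => (n x, Ψ x)) K := h1.prodMk h2
  have h4 := projS_cont.comp_continuousOn h3
  exact h4

theorem aux_spin_lift {K : Set V3} (hK : IsCompact K) (hc : Convex ℝ K) (n : V3 → V3)
    (hn : ContinuousOn n K) (hS : ∀ x ∈ K, n x ∈ sphereS) :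
    ∃ Ψ : V3 → ℂ × ℂ, ContinuousOn Ψ K ∧ ∀ x ∈ K, LiftS (n x) (Ψ x) := by
  rcases K.eq_empty_or_nonempty with rfl | ⟨x0, hx0⟩
  · exact ⟨0, by simp, by simp⟩
  obtain ⟨N, F, hF0, hFN, hFc, hFm, hFd⟩ := aux_chain hK hc x0 hx0 n hn 1 one_pos
  have hFS : ∀ i ≤ N, ∀ x ∈ K, F i x ∈ sphereS := by
    intro i hi x hx
    obtain ⟨w, hw, he⟩ := hFm i hi x hx
    rw [he]; exact hS w hw
  have key : ∀ i ≤ N, ∃ Ψ : V3 → ℂ × ℂ, ContinuousOn Ψ K ∧ ∀ x ∈ K, LiftS (F i x) (Ψ x) := by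
    intro i
    induction i with
    | zero =>
      intro _
      obtain ⟨p, hp⟩ := LiftS_exists (n x0) (hS x0 hx0)
      exact ⟨fun _ => p, continuousOn_const, fun x hx => by rw [hF0 x hx]; exact hp⟩
    | succ i ih =>
      intro hi
      obtain ⟨Ψ, hΨ, hL⟩ := ih (by omega)
      refine ⟨fun x => projS (F (i + 1) x) (Ψ x), ?_, ?_⟩
      · exact aux_projS (hFc (i + 1) hi) hΨ
      · intro x hx
        refine (hL x hx).proj (hFS (i + 1) hi x hx) ?_
        intro he
        have hd := hFd i (by omega) x hx
        have hs := hFS i (by omega) x hx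
        rw [mem_sphereS] at hs
        rw [he, dist_pi_lt_iff one_pos] at hd
        have b : ∀ j, (F i x j) ^ 2 < 1 / 4 := by
          intro j
          have := hd j
          rw [Real.dist_eq, Pi.neg_apply, abs_lt] at this
          nlinarith
        linarith [b 0, b 1, b 2]
  obtain ⟨Ψ, hΨ, hL⟩ := key N le_rfl
  exact ⟨Ψ, hΨ, fun x hx => by rw [← hFN x hx]; exact hL x hx⟩

/-! ### A Hopf-type homotopy lemma -/

theorem aux_lt_one {y : V3} (h : y ∈ sphereS) (hn : y ≠ npole) : y 2 < 1 := by
  rw [mem_sphereS] at h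
  by_contra hc
  push Not at hc
  apply hn
  have h2 : y 2 = 1 := by nlinarith [sq_nonneg (y 0), sq_nonneg (y 1)]
  rw [h2] at h
  have h0 : y 0 = 0 := by nlinarith [sq_nonneg (y 0), sq_nonneg (y 1)]
  have h1 : y 1 = 0 := by nlinarith [sq_nonneg (y 0), sq_nonneg (y 1)]
  ext i
  fin_cases i
  · simpa [npole] using h0
  · simpa [npole] using h1
  · simpa [npole] using h2

/-- Stereographic coordinate. -/
def st (y : V3) : ℂ := (starRingEnd ℂ) (zc y) / ((1 - y 2 : ℝ) : ℂ)

theorem st_cont : ContinuousOn st {y | y 2 < 1} := by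
  refine ContinuousOn.div (Complex.continuous_conj.comp zc_cont).continuousOn ?_ ?_
  · exact (Complex.continuous_ofReal.comp
      (continuous_const.sub (continuous_apply 2))).continuousOn
  · intro y hy
    have : (1 - y 2 : ℝ) ≠ 0 := by
      have : y 2 < 1 := hy
      linarith
    exact_mod_cast this

theorem st_lift {y : V3} (h : y ∈ sphereS) (hn : y ≠ npole) : hopf (1, st y) = y := by
  have h1 := aux_lt_one h hn
  rw [mem_sphereS] at h
  have hd : ((1 - y 2 : ℝ) : ℂ) ≠ 0 := by
    have : (1 - y 2 : ℝ) ≠ 0 := by linarith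
    exact_mod_cast this
  have hz : zc y * (starRingEnd ℂ) (zc y) = (1 - y 2 : ℝ) * (1 + y 2 : ℝ) := by
    rw [Complex.mul_conj, Complex.normSq_eq_norm_sq, zc_norm_sq, ← Complex.ofReal_mul]
    congr 1; linarith
  refine LiftS.hopf ⟨by simp, ?_, ?_⟩
  · simp only [st]
    field_simp
    rw [hz]; ring
  · simp only [st]
    field_simp

theorem zc_hopf (p : ℂ × ℂ) : zc (hopf p) =
    2 * p.1 * (starRingEnd ℂ) p.2 / ((Complex.normSq p.1 + Complex.normSq p.2 : ℝ) : ℂ) := by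
  apply Complex.ext
  · rw [zc_re, Complex.div_ofReal_re]
    simp [hopf]; ring
  · rw [zc_im, Complex.div_ofReal_im]
    simp [hopf]; ring

theorem st_hopf {p : ℂ × ℂ} (hp : p.1 ≠ 0) : p.1 * st (hopf p) = p.2 := by
  have h0 : p ≠ 0 := fun h => hp (by rw [h]; rfl)
  have hd := hopf_den h0
  have hd' : ((Complex.normSq p.1 + Complex.normSq p.2 : ℝ) : ℂ) ≠ 0 := by
    exact_mod_cast hd.ne'
  have e : ((1 - hopf p 2 : ℝ) : ℂ) = 2 * (p.1 * (starRingEnd ℂ) p.1) /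
      ((Complex.normSq p.1 + Complex.normSq p.2 : ℝ) : ℂ) := by
    rw [Complex.mul_conj]
    have : 1 - hopf p 2 = 2 * Complex.normSq p.1 /
      (Complex.normSq p.1 + Complex.normSq p.2) := by
      simp only [hopf, Matrix.cons_val]
      field_simp
      ring
    rw [this]; push_cast; ring
  have hp' : (starRingEnd ℂ) p.1 ≠ 0 := by simpa using hp
  rw [st, e, zc_hopf]
  simp only [map_div₀, map_mul, Complex.conj_ofReal, Complex.conj_conj, map_ofNat]
  field_simp

/-- Maps of the sphere in normal form with degree `k`. -/
def NiceData (f : V3 → V3) (k : ℤ) : Prop :=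
  ContinuousOn f sphereS ∧ MapsTo f sphereS sphereS ∧ (∀ x ∈ sphereS, x 2 ≤ 0 → f x ≠ npole) ∧
  ∃ Ψ : ℂ → ℂ × ℂ, ContinuousOn Ψ (Metric.closedBall 0 1) ∧
    (∀ ζ ∈ Metric.closedBall (0 : ℂ) 1, Ψ ζ ≠ 0) ∧
    (∀ x ∈ sphereS, 0 ≤ x 2 → f x = hopf (Ψ (zc x))) ∧ HW (fun ω => (Ψ ω).1) k

/-- The equator. -/
def eqt (ω : ℂ) : V3 := ![ω.re, ω.im, 0]

theorem eqt_cont : Continuous eqt := by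
  refine continuous_pi fun i => ?_
  fin_cases i
  · exact Complex.continuous_re
  · exact Complex.continuous_im
  · exact continuous_const

theorem zc_eqt (ω : ℂ) : zc (eqt ω) = ω := by
  apply Complex.ext
  · rw [zc_re]; simp [eqt]
  · rw [zc_im]; simp [eqt]

theorem eqt_mem {ω : ℂ} (h : ω ∈ Metric.sphere (0 : ℂ) 1) : eqt ω ∈ sphereS := by
  rw [mem_sphere_zero_iff_norm] at h
  have := zc_norm_sq (eqt ω)
  rw [zc_eqt, h] at this
  rw [mem_sphereS]
  rw [← this]; simp [eqt]

theorem eqt_zc {x : V3} (h : x 2 = 0) : eqt (zc x) = x := by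
  ext i
  fin_cases i
  · simp [eqt, zc_re]
  · simp [eqt, zc_im]
  · simp [eqt, h]

theorem zc_mem_sphere {x : V3} (hx : x ∈ sphereS) (h : x 2 = 0) :
    zc x ∈ Metric.sphere (0 : ℂ) 1 := by
  rw [mem_sphere_zero_iff_norm]
  rw [mem_sphereS, h] at hx
  have := zc_norm_sq x
  have := norm_nonneg (zc x)
  nlinarith

theorem NiceData.equator {f : V3 → V3} {k : ℤ} (h : NiceData f k) :
    ∃ (Ψ : ℂ → ℂ × ℂ) (l g : ℂ → ℂ), ContinuousOn Ψ (Metric.closedBall 0 1) ∧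
    (∀ ζ ∈ Metric.closedBall (0 : ℂ) 1, Ψ ζ ≠ 0) ∧
    (∀ x ∈ sphereS, 0 ≤ x 2 → f x = hopf (Ψ (zc x))) ∧
    ContinuousOn l (Metric.sphere 0 1) ∧ ContinuousOn g (Metric.sphere 0 1) ∧
    (∀ ω ∈ Metric.sphere (0 : ℂ) 1, l ω = st (f (eqt ω))) ∧
    (∀ ω ∈ Metric.sphere (0 : ℂ) 1, Ψ ω = (ω ^ k * Complex.exp (g ω),
      ω ^ k * Complex.exp (g ω) * l ω)) := by
  obtain ⟨hc, hm, hs, Ψ, hΨ, hΨ0, hf, g, hg, hgk⟩ := h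
  refine ⟨Ψ, fun ω => st (f (eqt ω)), g, hΨ, hΨ0, hf, ?_, hg, fun _ _ => rfl, ?_⟩
  · refine st_cont.comp (hc.comp eqt_cont.continuousOn fun ω h => eqt_mem h) ?_
    intro ω h
    exact aux_lt_one (hm (eqt_mem h)) (hs _ (eqt_mem h) (by simp [eqt]))
  · intro ω hω
    have e := hf (eqt ω) (eqt_mem hω) (by simp [eqt])
    rw [zc_eqt] at e
    have h1 := hgk ω hω
    simp only [] at h1
    have hne : (Ψ ω).1 ≠ 0 := by
      rw [h1]
      exact mul_ne_zero (zpow_ne_zero _ (aux_sphere_ne hω)) (Complex.exp_ne_zero _)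
    have h2 := st_hopf hne
    rw [← e] at h2
    rw [← h1, h2]

theorem hopf_one_ne (v : ℂ) : ((1 : ℂ), v) ≠ 0 := by simp

theorem nice_homotopic {f₀ f₁ : V3 → V3} {k : ℤ} (h₀ : NiceData f₀ k) (h₁ : NiceData f₁ k) :
    SphHomotopic f₀ f₁ := by
  obtain ⟨Ψ₀, l₀, g₀, hΨ₀, hΨ₀n, hf₀, hl₀, hg₀, hl₀e, hΨ₀e⟩ := h₀.equator
  obtain ⟨Ψ₁, l₁, g₁, hΨ₁, hΨ₁n, hf₁, hl₁, hg₁, hl₁e, hΨ₁e⟩ := h₁.equator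
  obtain ⟨hc₀, hm₀, hs₀, -⟩ := h₀
  obtain ⟨hc₁, hm₁, hs₁, -⟩ := h₁
  let A : Fin 3 → Set (ℝ × ℂ) := ![{0} ×ˢ Metric.closedBall 0 1, {1} ×ˢ Metric.closedBall 0 1,
    Icc 0 1 ×ˢ Metric.sphere 0 1]
  let cc : ℝ × ℂ → ℂ := fun q => q.2 ^ k *
    Complex.exp ((1 - q.1 : ℝ) * g₀ q.2 + (q.1 : ℝ) * g₁ q.2)
  let ll : ℝ × ℂ → ℂ := fun q => (1 - q.1 : ℝ) * l₀ q.2 + (q.1 : ℝ) * l₁ q.2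
  let F : Fin 3 → ℝ × ℂ → ℂ × ℂ := ![fun q => Ψ₀ q.2, fun q => Ψ₁ q.2,
    fun q => (cc q, cc q * ll q)]
  have hAcl : ∀ i, IsCompact (A i) := by
    intro i
    fin_cases i
    · exact isCompact_singleton.prod (isCompact_closedBall _ _)
    · exact isCompact_singleton.prod (isCompact_closedBall _ _)
    · exact isCompact_Icc.prod (isCompact_sphere _ _)
  have c1 : ∀ S : Set (ℝ × ℂ), ContinuousOn (fun q : ℝ × ℂ => ((1 - q.1 : ℝ) : ℂ)) S := fun S =>
    (Complex.continuous_ofReal.comp (continuous_const.sub continuous_fst)).continuousOn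
  have c2 : ∀ S : Set (ℝ × ℂ), ContinuousOn (fun q : ℝ × ℂ => ((q.1 : ℝ) : ℂ)) S := fun S =>
    (Complex.continuous_ofReal.comp continuous_fst).continuousOn
  have csnd : ∀ S : Set (ℝ × ℂ), ContinuousOn (fun q : ℝ × ℂ => q.2) S := fun S =>
    continuous_snd.continuousOn
  have hcc : ContinuousOn cc (Icc (0:ℝ) 1 ×ˢ Metric.sphere 0 1) := by
    have m : MapsTo (fun q : ℝ × ℂ => q.2) (Icc (0:ℝ) 1 ×ˢ Metric.sphere 0 1)
      (Metric.sphere 0 1) := fun q hq => hq.2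
    have a1 := hg₀.comp (csnd _) m
    have a2 := hg₁.comp (csnd _) m
    refine ContinuousOn.mul ?_ ?_
    · exact (csnd _).zpow₀ k fun q hq => Or.inl (aux_sphere_ne hq.2)
    · exact (((c1 _).mul a1).add ((c2 _).mul a2)).cexp
  have hll : ContinuousOn ll (Icc (0:ℝ) 1 ×ˢ Metric.sphere 0 1) := by
    have m : MapsTo (fun q : ℝ × ℂ => q.2) (Icc (0:ℝ) 1 ×ˢ Metric.sphere 0 1)
      (Metric.sphere 0 1) := fun q hq => hq.2
    have a1 := hl₀.comp (csnd _) m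
    have a2 := hl₁.comp (csnd _) m
    exact ((c1 _).mul a1).add ((c2 _).mul a2)
  have hccn : ∀ q ∈ Icc (0:ℝ) 1 ×ˢ Metric.sphere (0 : ℂ) 1, cc q ≠ 0 := fun q hq =>
    mul_ne_zero (zpow_ne_zero _ (aux_sphere_ne hq.2)) (Complex.exp_ne_zero _)
  have hF : ∀ i, ContinuousOn (F i) (A i) := by
    intro i
    fin_cases i
    · exact hΨ₀.comp (csnd _) fun q hq => hq.2
    · exact hΨ₁.comp (csnd _) fun q hq => hq.2
    · exact hcc.prodMk (hcc.mul hll)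
  have h02 : ∀ q, q ∈ A 0 → q ∈ A 2 → F 0 q = F 2 q := by
    rintro ⟨t, ω⟩ h1 h2
    have ht : t = 0 := h1.1
    have hω : ω ∈ Metric.sphere (0 : ℂ) 1 := h2.2
    have := hΨ₀e ω hω
    simp only [F, cc, ll, ht, Matrix.cons_val_zero, Matrix.cons_val]
    rw [this]; simp
  have h12 : ∀ q, q ∈ A 1 → q ∈ A 2 → F 1 q = F 2 q := by
    rintro ⟨t, ω⟩ h1 h2
    have ht : t = 1 := h1.1
    have hω : ω ∈ Metric.sphere (0 : ℂ) 1 := h2.2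
    have := hΨ₁e ω hω
    simp only [F, cc, ll, ht, Matrix.cons_val_one, Matrix.cons_val_zero, Matrix.cons_val]
    rw [this]; simp
  have h01 : ∀ q, q ∈ A 0 → q ∈ A 1 → F 0 q = F 1 q := by
    rintro ⟨t, ω⟩ h1 h2
    have ht : t = 0 := h1.1
    have ht' : t = 1 := h2.1
    exact absurd (ht.symm.trans ht') zero_ne_one
  obtain ⟨B, hB, hBe⟩ := aux_glue A (fun i => (hAcl i).isClosed) F hF (by
    intro i j q hi hj
    fin_cases i <;> fin_cases j
    · rfl
    · exact h01 q hi hj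
    · exact h02 q hi hj
    · exact (h01 q hj hi).symm
    · rfl
    · exact h12 q hi hj
    · exact (h02 q hj hi).symm
    · exact (h12 q hj hi).symm
    · rfl)
  have hcompA : IsCompact (⋃ i, A i) := isCompact_iUnion hAcl
  obtain ⟨H, hH, hHe⟩ := aux_tietze hcompA.isClosed B hB
  have hne : ∀ q ∈ ⋃ i, A i, H q ≠ 0 := by
    intro q hq
    rw [hHe q hq]
    obtain ⟨i, hi⟩ := mem_iUnion.1 hq
    rw [hBe i q hi]
    fin_cases i
    · exact hΨ₀n _ hi.2
    · exact hΨ₁n _ hi.2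
    · intro h
      exact hccn q hi (congrArg Prod.fst h)
  obtain ⟨H', hH', hHe', hHn'⟩ := aux_nonvanish _ hcompA H hH hne
  have hval : ∀ i, ∀ q ∈ A i, H' q = F i q := by
    intro i q hq
    have := mem_iUnion_of_mem (s := A) i hq
    rw [hHe' q this, hHe q this, hBe i q hq]
  have hlow : ∀ x ∈ sphereS, x 2 ≤ 0 → f₀ x 2 < 1 := fun x hx h =>
    aux_lt_one (hm₀ hx) (hs₀ x hx h)
  have hlow1 : ∀ x ∈ sphereS, x 2 ≤ 0 → f₁ x 2 < 1 := fun x hx h =>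
    aux_lt_one (hm₁ hx) (hs₁ x hx h)
  let G1 : ℝ × V3 → V3 := fun q => hopf (H' (q.1, zc q.2))
  let G2 : ℝ × V3 → V3 := fun q => hopf (1, (1 - q.1 : ℝ) * st (f₀ q.2) + (q.1 : ℝ) * st (f₁ q.2))
  have hG12 : ∀ t ∈ Icc (0:ℝ) 1, ∀ x ∈ sphereS, x 2 = 0 → G1 (t, x) = G2 (t, x) := by
    intro t ht x hx h
    have hω := zc_mem_sphere hx h
    have e := hval 2 (t, zc x) ⟨ht, hω⟩
    simp only [G1, G2]
    rw [e]
    have := hopf_smul (cc (t, zc x)) (hccn (t, zc x) ⟨ht, hω⟩) (1, ll (t, zc x))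
    rw [mul_one] at this
    have e2 : F 2 (t, zc x) = (cc (t, zc x), cc (t, zc x) * ll (t, zc x)) := rfl
    rw [e2, this]
    simp only [ll]
    rw [hl₀e _ hω, hl₁e _ hω, eqt_zc h]
  have hG1 : ∀ S, ContinuousOn G1 S := by
    intro S
    refine hopf_cont.comp (t := {p | p ≠ 0}) (Continuous.continuousOn ?_) fun q _ => hHn' _
    exact hH'.comp (continuous_fst.prodMk (zc_cont.comp continuous_snd))
  have hG2 : ContinuousOn G2 (Icc 0 1 ×ˢ (sphereS ∩ {x | x 2 ≤ 0})) := by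
    refine hopf_cont.comp (t := {p | p ≠ 0}) ?_ fun q _ => hopf_one_ne _
    refine ContinuousOn.prodMk continuousOn_const ?_
    have s0 : ContinuousOn (fun q : ℝ × V3 => f₀ q.2) (Icc 0 1 ×ˢ (sphereS ∩ {x | x 2 ≤ 0})) :=
      hc₀.comp continuous_snd.continuousOn fun q hq => hq.2.1
    have s1 : ContinuousOn (fun q : ℝ × V3 => f₁ q.2) (Icc 0 1 ×ˢ (sphereS ∩ {x | x 2 ≤ 0})) :=
      hc₁.comp continuous_snd.continuousOn fun q hq => hq.2.1
    have t0 := st_cont.comp s0 fun q hq => hlow q.2 hq.2.1 hq.2.2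
    have t1 := st_cont.comp s1 fun q hq => hlow1 q.2 hq.2.1 hq.2.2
    have d1 : Continuous (fun q : ℝ × V3 => ((1 - q.1 : ℝ) : ℂ)) :=
      Complex.continuous_ofReal.comp (continuous_const.sub continuous_fst)
    have d2 : Continuous (fun q : ℝ × V3 => ((q.1 : ℝ) : ℂ)) :=
      Complex.continuous_ofReal.comp continuous_fst
    exact (d1.continuousOn.mul t0).add (d2.continuousOn.mul t1)
  have hcl1 : IsClosed ((Icc 0 1 : Set ℝ) ×ˢ (sphereS ∩ {x | 0 ≤ x 2})) :=
    isClosed_Icc.prod (sphereS_closed.inter (isClosed_le continuous_const (continuous_apply 2)))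
  have hcl2 : IsClosed ((Icc 0 1 : Set ℝ) ×ˢ (sphereS ∩ {x | x 2 ≤ 0})) :=
    isClosed_Icc.prod (sphereS_closed.inter (isClosed_le (continuous_apply 2) continuous_const))
  refine ⟨fun t x => if 0 ≤ x 2 then G1 (t, x) else G2 (t, x), ?_, ?_, ?_, ?_⟩
  · have e : (Icc 0 1 : Set ℝ) ×ˢ sphereS = (Icc 0 1 : Set ℝ) ×ˢ (sphereS ∩ {x | 0 ≤ x 2}) ∪
        (Icc 0 1 : Set ℝ) ×ˢ (sphereS ∩ {x | x 2 ≤ 0}) := by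
      rw [← prod_union, ← inter_union_distrib_left]
      congr 1
      ext x
      simp only [mem_inter_iff, mem_union, Set.mem_ofPred_eq]
      exact ⟨fun h => ⟨h, le_total _ _⟩, fun h => h.1⟩
    rw [e]
    refine ContinuousOn.union_of_isClosed ?_ ?_ hcl1 hcl2
    · refine (hG1 _).congr fun q hq => ?_
      exact if_pos hq.2.2
    · refine hG2.congr fun q hq => ?_
      by_cases h : 0 ≤ q.2 2
      · simp only [if_pos h]
        exact hG12 q.1 hq.1 q.2 hq.2.1 (le_antisymm hq.2.2 h)
      · simp only [if_neg h]
  · intro t ht x hx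
    simp only []
    split_ifs
    · exact hopf_mem (hHn' _)
    · exact hopf_mem (hopf_one_ne _)
  · intro x hx
    simp only []
    split_ifs with h
    · simp only [G1]
      rw [hval 0 (0, zc x) ⟨rfl, zc_mem_ball hx⟩, hf₀ x hx h]
      rfl
    · simp only [G2]
      have := st_lift (hm₀ hx) (hs₀ x hx (not_le.1 h).le)
      simpa using this
  · intro x hx
    simp only []
    split_ifs with h
    · simp only [G1]
      rw [hval 1 (1, zc x) ⟨rfl, zc_mem_ball hx⟩, hf₁ x hx h]
      rfl
    · simp only [G2]
      have := st_lift (hm₁ hx) (hs₁ x hx (not_le.1 h).le)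
      simpa using this

/-! ### The standard maps and rotations -/

/-- Planar power map. -/
def pk (k : ℤ) (ζ : ℂ) : ℂ := ‖ζ‖ * (ζ / (‖ζ‖ : ℂ)) ^ k

theorem pk_norm (k : ℤ) (ζ : ℂ) : ‖pk k ζ‖ = ‖ζ‖ := by
  by_cases h : ζ = 0
  · simp [pk, h]
  · have : ‖ζ‖ ≠ 0 := norm_ne_zero_iff.2 h
    simp [pk, norm_zpow, this]

theorem pk_cont (k : ℤ) : Continuous (pk k) := by
  rw [continuous_iff_continuousAt]
  intro ζ
  by_cases h : ζ = 0
  · have e : pk k ζ = 0 := by simp [pk, h]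
    rw [ContinuousAt, e, tendsto_zero_iff_norm_tendsto_zero]
    simp only [pk_norm]
    have := (continuous_norm (E := ℂ)).tendsto ζ
    rwa [h, norm_zero, ← h] at this
  · have hn : (‖ζ‖ : ℂ) ≠ 0 := by exact_mod_cast norm_ne_zero_iff.2 h
    have c : ContinuousAt (fun ζ : ℂ => (‖ζ‖ : ℂ)) ζ :=
      (Complex.continuous_ofReal.comp continuous_norm).continuousAt
    exact c.mul ((continuousAt_id.div c hn).zpow₀ k (Or.inl (div_ne_zero h hn)))

theorem powMap_eq (k : ℤ) (x : V3) :
    powMap k x = ![(pk k (zc x)).re, (pk k (zc x)).im, x 2] := by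
  have hz : ((x 0 : ℂ) + (x 1 : ℂ) * Complex.I) = zc x := rfl
  unfold powMap
  rw [hz]
  split_ifs with h
  · have h0 := zc_re x
    have h1 := zc_im x
    rw [h] at h0 h1
    ext i
    fin_cases i
    · simpa [pk, h] using h0.symm
    · simpa [pk, h] using h1.symm
    · simp
  · simp only [pk, Complex.re_ofReal_mul, Complex.im_ofReal_mul]

theorem zc_powMap (k : ℤ) (x : V3) : zc (powMap k x) = pk k (zc x) := by
  apply Complex.ext
  · rw [zc_re, powMap_eq]; simp
  · rw [zc_im, powMap_eq]; simp

theorem powMap_two (k : ℤ) (x : V3) : powMap k x 2 = x 2 := by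
  rw [powMap_eq]; simp

theorem powMap_mem (k : ℤ) {x : V3} (hx : x ∈ sphereS) : powMap k x ∈ sphereS := by
  rw [mem_sphereS] at hx ⊢
  have := zc_norm_sq (powMap k x)
  rw [zc_powMap, pk_norm, zc_norm_sq] at this
  rw [powMap_two, ← this, hx]

theorem powMap_nice (k : ℤ) : NiceData (powMap k) k := by
  refine ⟨?_, fun x hx => powMap_mem k hx, ?_, fun ζ => (pk k ζ, ((1 + Real.sqrt (1 - ‖ζ‖ ^ 2) : ℝ) : ℂ)),
    ?_, ?_, ?_, ?_⟩
  · have : powMap k = fun x => ![(pk k (zc x)).re, (pk k (zc x)).im, x 2] :=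
      funext (powMap_eq k)
    rw [this]
    apply Continuous.continuousOn
    refine continuous_pi fun i => ?_
    fin_cases i
    · exact Complex.continuous_re.comp ((pk_cont k).comp zc_cont)
    · exact Complex.continuous_im.comp ((pk_cont k).comp zc_cont)
    · exact continuous_apply 2
  · intro x hx h he
    have := congrFun he 2
    rw [powMap_two] at this
    simp [npole] at this
    linarith
  · apply Continuous.continuousOn
    refine (pk_cont k).prodMk (Complex.continuous_ofReal.comp ?_)
    fun_prop
  · intro ζ _ h0
    have : ((1 + Real.sqrt (1 - ‖ζ‖ ^ 2) : ℝ) : ℂ) = 0 := congrArg Prod.snd h0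
    have : 1 + Real.sqrt (1 - ‖ζ‖ ^ 2) = 0 := by exact_mod_cast this
    linarith [Real.sqrt_nonneg (1 - ‖ζ‖ ^ 2)]
  · intro x hx h
    symm
    have hx' := (mem_sphereS x).1 hx
    have e : Real.sqrt (1 - ‖zc x‖ ^ 2) = x 2 := by
      rw [zc_norm_sq, show 1 - (x 0 ^ 2 + x 1 ^ 2) = x 2 ^ 2 by linarith, Real.sqrt_sq h]
    simp only [e]
    refine LiftS.hopf ⟨?_, ?_, ?_⟩
    · intro h0
      have : ((1 + x 2 : ℝ) : ℂ) = 0 := congrArg Prod.snd h0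
      have : 1 + x 2 = 0 := by exact_mod_cast this
      linarith
    · simp only [zc_powMap, powMap_two]; ring
    · simp only [zc_powMap, powMap_two]
      rw [mul_comm, Complex.mul_conj, Complex.normSq_eq_norm_sq, pk_norm, zc_norm_sq,
        ← Complex.ofReal_mul]
      congr 1; linarith
  · refine ⟨fun _ => 0, continuousOn_const, fun ω hω => ?_⟩
    rw [mem_sphere_zero_iff_norm] at hω
    simp [pk, hω]

theorem nice_deg {deg : (V3 → V3) → ℤ} (hd : DegreeTheory deg) {f : V3 → V3} {k : ℤ}
    (h : NiceData f k) : deg f = k := by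
  have hp := powMap_nice k
  rw [hd.1 f (powMap k) h.1 h.2.1 hp.1 hp.2.1 (nice_homotopic h hp), hd.2]

/-- Rotation about the vertical axis, then about the second axis. -/
def Rt (a b : ℝ) (x : V3) : V3 :=
  ![Real.cos a * (Real.cos b * x 0 + Real.sin b * x 1) - Real.sin a * x 2,
    -Real.sin b * x 0 + Real.cos b * x 1,
    Real.sin a * (Real.cos b * x 0 + Real.sin b * x 1) + Real.cos a * x 2]

theorem Rt_zero (x : V3) : Rt 0 0 x = x := by
  ext i
  fin_cases i <;> simp [Rt]

theorem Rt_dot (a b : ℝ) (x : V3) : (Rt a b x) 0 ^ 2 + (Rt a b x) 1 ^ 2 + (Rt a b x) 2 ^ 2 =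
    x 0 ^ 2 + x 1 ^ 2 + x 2 ^ 2 := by
  have ha := Real.sin_sq_add_cos_sq a
  have hb := Real.sin_sq_add_cos_sq b
  simp only [Rt, Matrix.cons_val_zero, Matrix.cons_val_one, Matrix.cons_val]
  linear_combination ((Real.cos b * x 0 + Real.sin b * x 1) ^ 2 + x 2 ^ 2) * ha +
    (x 0 ^ 2 + x 1 ^ 2) * hb

theorem Rt_mem {a b : ℝ} {x : V3} (h : x ∈ sphereS) : Rt a b x ∈ sphereS := by
  rw [mem_sphereS] at h ⊢
  rw [Rt_dot, h]

theorem Rt_sub (a b : ℝ) (x y : V3) : Rt a b (x - y) = Rt a b x - Rt a b y := by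
  ext i
  fin_cases i <;> simp [Rt] <;> ring

theorem Rt_inj {a b : ℝ} {x y : V3} (h : Rt a b x = Rt a b y) : x = y := by
  have h1 := Rt_dot a b (x - y)
  rw [Rt_sub, h, sub_self] at h1
  simp only [Pi.zero_apply, Pi.sub_apply] at h1
  have : ∀ i, x i - y i = 0 := by
    intro i
    fin_cases i
    · show x 0 - y 0 = 0
      nlinarith [sq_nonneg (x 0 - y 0), sq_nonneg (x 1 - y 1), sq_nonneg (x 2 - y 2)]
    · show x 1 - y 1 = 0
      nlinarith [sq_nonneg (x 0 - y 0), sq_nonneg (x 1 - y 1), sq_nonneg (x 2 - y 2)]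
    · show x 2 - y 2 = 0
      nlinarith [sq_nonneg (x 0 - y 0), sq_nonneg (x 1 - y 1), sq_nonneg (x 2 - y 2)]
  ext i
  linarith [this i]

theorem Rt_cont : Continuous fun q : ℝ × ℝ × V3 => Rt q.1 q.2.1 q.2.2 := by
  refine continuous_pi fun i => ?_
  have ca : Continuous fun q : ℝ × ℝ × V3 => Real.cos q.1 := by fun_prop
  have sa : Continuous fun q : ℝ × ℝ × V3 => Real.sin q.1 := by fun_prop
  have cb : Continuous fun q : ℝ × ℝ × V3 => Real.cos q.2.1 := by fun_prop
  have sb : Continuous fun q : ℝ × ℝ × V3 => Real.sin q.2.1 := by fun_prop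
  have x : ∀ i, Continuous fun q : ℝ × ℝ × V3 => q.2.2 i := fun i => by fun_prop
  fin_cases i
  · exact (ca.mul ((cb.mul (x 0)).add (sb.mul (x 1)))).sub (sa.mul (x 2))
  · exact (sb.neg.mul (x 0)).add (cb.mul (x 1))
  · exact (sa.mul ((cb.mul (x 0)).add (sb.mul (x 1)))).add (ca.mul (x 2))

theorem Rt_cont' (a b : ℝ) : Continuous (Rt a b) := by
  have := Rt_cont.comp (continuous_const.prodMk (continuous_const.prodMk continuous_id) :
    Continuous fun x : V3 => ((a, b, x) : ℝ × ℝ × V3))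
  exact this

theorem Rt_pole {s : V3} (hs : s ∈ sphereS) :
    Rt (Real.arccos (s 2)) (Complex.arg (zc s)) s = npole := by
  have h := (mem_sphereS s).1 hs
  have h2 : Real.cos (Real.arccos (s 2)) = s 2 :=
    Real.cos_arccos (by nlinarith [sq_nonneg (s 0), sq_nonneg (s 1)])
      (by nlinarith [sq_nonneg (s 0), sq_nonneg (s 1)])
  have h3 : Real.sin (Real.arccos (s 2)) = ‖zc s‖ := by
    rw [Real.sin_arccos, zc_norm]; congr 1; linarith
  have e0 := Complex.norm_mul_cos_arg (zc s)
  have e1 := Complex.norm_mul_sin_arg (zc s)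
  rw [zc_re] at e0
  rw [zc_im] at e1
  set r := ‖zc s‖
  set c := Real.cos (Complex.arg (zc s))
  set d := Real.sin (Complex.arg (zc s))
  have hcd : c ^ 2 + d ^ 2 = 1 := Real.cos_sq_add_sin_sq _
  have e : c * s 0 + d * s 1 = r := by rw [← e0, ← e1]; linear_combination r * hcd
  have hr : r ^ 2 = 1 - s 2 ^ 2 := by
    have := zc_norm_sq s
    simp only [r]; linarith
  ext i
  fin_cases i
  · simp only [Rt, npole, Fin.zero_eta, Matrix.cons_val_zero]
    rw [h2, h3, e]; ring
  · simp only [Rt, npole, Fin.mk_one, Matrix.cons_val_one, Matrix.cons_val_zero]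
    rw [← e0, ← e1]; ring
  · simp only [Rt, npole, Fin.reduceFinMk, Matrix.cons_val]
    rw [h2, h3, e]; nlinarith

theorem rot_exists {s : V3} (hs : s ∈ sphereS) : ∃ R : V3 → V3, Continuous R ∧
    MapsTo R sphereS sphereS ∧ (∀ x, R x = npole → x = s) ∧
    ∀ deg, DegreeTheory deg → ∀ f : V3 → V3, ContinuousOn f sphereS → MapsTo f sphereS sphereS →
      deg f = deg (fun x => R (f x)) := by
  refine ⟨Rt (Real.arccos (s 2)) (Complex.arg (zc s)), Rt_cont' _ _, fun x hx => Rt_mem hx, ?_, ?_⟩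
  · intro x hx
    rw [← Rt_pole hs] at hx
    exact Rt_inj hx
  · intro deg hd f hf hm
    refine hd.1 f _ hf hm ((Rt_cont' _ _).comp_continuousOn hf) (fun x hx => Rt_mem (hm hx)) ?_
    refine ⟨fun t x => Rt (t * Real.arccos (s 2)) (t * Complex.arg (zc s)) (f x), ?_, ?_, ?_, ?_⟩
    · have c1 : Continuous fun q : ℝ × V3 => q.1 * Real.arccos (s 2) :=
        continuous_fst.mul continuous_const
      have c2 : Continuous fun q : ℝ × V3 => q.1 * Complex.arg (zc s) :=
        continuous_fst.mul continuous_const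
      have c3 : ContinuousOn (fun q : ℝ × V3 => f q.2) (Icc (0:ℝ) 1 ×ˢ sphereS) :=
        hf.comp continuous_snd.continuousOn fun q hq => hq.2
      have := Rt_cont.comp_continuousOn (c1.continuousOn.prodMk (c2.continuousOn.prodMk c3))
      exact this
    · intro t ht x hx
      exact Rt_mem (hm hx)
    · intro x hx
      simp only [zero_mul]
      exact Rt_zero _
    · intro x hx
      simp only [one_mul]

/-! ### The wrapping map -/

theorem aux_polar {Z : Type*} [TopologicalSpace Z] (T : ℝ → ℝ → Z)
    (hT : ContinuousOn (fun q : ℝ × ℝ => T q.1 q.2) (Icc 0 1 ×ˢ Icc (-Real.pi) Real.pi))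
    (hper : ∀ ρ, T ρ (-Real.pi) = T ρ Real.pi) (h0 : ∀ φ ψ, T 0 φ = T 0 ψ) :
    ContinuousOn (fun ζ : ℂ => T ‖ζ‖ (Complex.arg ζ)) (Metric.closedBall 0 1) := by
  refine aux_quot (A := Icc (0:ℝ) 1 ×ˢ Icc (-Real.pi) Real.pi) (isCompact_Icc.prod isCompact_Icc)
    (fun q : ℝ × ℝ => (q.1 : ℂ) * Complex.exp (q.2 * Complex.I)) ?_ ?_ ?_ _ ?_
  · fun_prop
  · intro ζ hζ
    rw [mem_closedBall_zero_iff] at hζ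
    refine ⟨(‖ζ‖, Complex.arg ζ), ⟨⟨norm_nonneg _, hζ⟩, (Complex.neg_pi_lt_arg ζ).le,
      Complex.arg_le_pi ζ⟩, ?_⟩
    exact Complex.norm_mul_exp_arg_mul_I ζ
  · rintro ⟨ρ, φ⟩ ⟨hρ, hφ⟩
    rw [mem_closedBall_zero_iff]
    simp only [norm_mul, Complex.norm_exp_ofReal_mul_I, mul_one, Complex.norm_real,
      Real.norm_eq_abs]
    rw [abs_of_nonneg hρ.1]
    exact hρ.2
  · refine hT.congr ?_
    rintro ⟨ρ, φ⟩ ⟨hρ, hφ⟩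
    have hn : ‖(ρ : ℂ) * Complex.exp (φ * Complex.I)‖ = ρ := by
      simp only [norm_mul, Complex.norm_exp_ofReal_mul_I, mul_one, Complex.norm_real,
        Real.norm_eq_abs]
      exact abs_of_nonneg hρ.1
    simp only [hn]
    rcases hρ.1.eq_or_lt with h | h
    · have h' : ρ = 0 := h.symm
      subst h'
      exact h0 _ _
    · have hh : 0 < ρ := h
      rw [Complex.arg_real_mul _ hh]
      exact aux_arg_exp (T ρ) (hper ρ) hφ

theorem dot_le_one {p a : V3} (hp : p ∈ sphereS) (ha : a ∈ sphereS) : p ⬝ᵥ a ≤ 1 ∧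
    (p ⬝ᵥ a = 1 → p = a) := by
  rw [mem_sphereS] at hp ha
  have e : p ⬝ᵥ a = p 0 * a 0 + p 1 * a 1 + p 2 * a 2 := by
    simp [dotProduct, Fin.sum_univ_three]
  have key : (p 0 - a 0) ^ 2 + (p 1 - a 1) ^ 2 + (p 2 - a 2) ^ 2 = 2 - 2 * (p ⬝ᵥ a) := by
    rw [e]; linear_combination hp + ha
  refine ⟨by nlinarith [sq_nonneg (p 0 - a 0), sq_nonneg (p 1 - a 1), sq_nonneg (p 2 - a 2)], ?_⟩
  intro h
  rw [h] at key
  have h0 : p 0 - a 0 = 0 := by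
    nlinarith [sq_nonneg (p 0 - a 0), sq_nonneg (p 1 - a 1), sq_nonneg (p 2 - a 2)]
  have h1 : p 1 - a 1 = 0 := by
    nlinarith [sq_nonneg (p 0 - a 0), sq_nonneg (p 1 - a 1), sq_nonneg (p 2 - a 2)]
  have h2 : p 2 - a 2 = 0 := by
    nlinarith [sq_nonneg (p 0 - a 0), sq_nonneg (p 1 - a 1), sq_nonneg (p 2 - a 2)]
  ext i
  fin_cases i
  · exact sub_eq_zero.1 h0
  · exact sub_eq_zero.1 h1
  · exact sub_eq_zero.1 h2

theorem neg_mem_sphereS {p : V3} (hp : p ∈ sphereS) : -p ∈ sphereS := by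
  rw [mem_sphereS] at hp ⊢
  simpa using hp

theorem geo_angle {p a : V3} (hp : p ∈ sphereS) (ha : a ∈ sphereS) (h1 : p ≠ a) (h2 : -p ≠ a) :
    Real.cos (Real.arccos (p ⬝ᵥ a)) = p ⬝ᵥ a ∧ 0 < Real.arccos (p ⬝ᵥ a) ∧
    Real.arccos (p ⬝ᵥ a) < Real.pi ∧ 0 < Real.sin (Real.arccos (p ⬝ᵥ a)) := by
  obtain ⟨l1, e1⟩ := dot_le_one hp ha
  obtain ⟨l2, e2⟩ := dot_le_one (neg_mem_sphereS hp) ha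
  rw [neg_dotProduct] at l2 e2
  have l1' : p ⬝ᵥ a < 1 := lt_of_le_of_ne l1 fun h => h1 (e1 h)
  have l2' : -1 < p ⬝ᵥ a := by
    have : -(p ⬝ᵥ a) < 1 := lt_of_le_of_ne l2 fun h => h2 (e2 h)
    linarith
  have c0 : 0 < Real.arccos (p ⬝ᵥ a) := Real.arccos_pos.2 l1'
  have c1 : Real.arccos (p ⬝ᵥ a) < Real.pi := by
    rw [← Real.arccos_neg_one]
    exact Real.arccos_lt_arccos le_rfl l2' l1
  exact ⟨Real.cos_arccos l2'.le l1, c0, c1, Real.sin_pos_of_pos_of_lt_pi c0 c1⟩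

theorem geo_one {p a : V3} (hp : p ∈ sphereS) (ha : a ∈ sphereS) (h1 : p ≠ a) (h2 : -p ≠ a) :
    geo p a 1 = a := by
  obtain ⟨-, -, -, hs⟩ := geo_angle hp ha h1 h2
  simp [geo, h1, div_self hs.ne']

theorem geo_zero {p a : V3} (hp : p ∈ sphereS) (ha : a ∈ sphereS) (h1 : p ≠ a) (h2 : -p ≠ a) :
    geo p a 0 = p := by
  obtain ⟨-, -, -, hs⟩ := geo_angle hp ha h1 h2
  simp [geo, h1, div_self hs.ne']

theorem geo_mem {p a : V3} (hp : p ∈ sphereS) (ha : a ∈ sphereS) (h1 : p ≠ a) (h2 : -p ≠ a)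
    (ρ : ℝ) : geo p a ρ ∈ sphereS := by
  obtain ⟨hc, -, -, hs⟩ := geo_angle hp ha h1 h2
  have hp' : p ⬝ᵥ p = 1 := hp
  have ha' : a ⬝ᵥ a = 1 := ha
  show geo p a ρ ⬝ᵥ geo p a ρ = 1
  simp only [geo, if_neg h1]
  set θ := Real.arccos (p ⬝ᵥ a)
  simp only [add_dotProduct, dotProduct_add, smul_dotProduct, dotProduct_smul, smul_eq_mul]
  rw [hp', ha', dotProduct_comm a p, ← hc]
  have eθ : θ = (1 - ρ) * θ + ρ * θ := by ring
  have es : Real.sin θ = Real.sin ((1 - ρ) * θ) * Real.cos (ρ * θ) +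
      Real.cos ((1 - ρ) * θ) * Real.sin (ρ * θ) := by
    rw [← Real.sin_add]; congr 1
  have ec : Real.cos θ = Real.cos ((1 - ρ) * θ) * Real.cos (ρ * θ) -
      Real.sin ((1 - ρ) * θ) * Real.sin (ρ * θ) := by
    rw [← Real.cos_add]; congr 1
  have q1 := Real.sin_sq_add_cos_sq ((1 - ρ) * θ)
  have q2 := Real.sin_sq_add_cos_sq (ρ * θ)
  generalize Real.sin ((1 - ρ) * θ) = A at *
  generalize Real.cos ((1 - ρ) * θ) = A' at *
  generalize Real.sin (ρ * θ) = B at *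
  generalize Real.cos (ρ * θ) = B' at *
  generalize Real.sin θ = S at *
  generalize Real.cos θ = C at *
  field_simp
  rw [es, ec]
  linear_combination (-B ^ 2) * q1 + (-A ^ 2) * q2

theorem geo_ne {p a : V3} (hp : p ∈ sphereS) (ha : a ∈ sphereS) (h1 : p ≠ a) (h2 : -p ≠ a)
    {ρ : ℝ} (hρ : ρ ∈ Icc (0:ℝ) 1) : geo p a ρ ≠ -p := by
  obtain ⟨hc, h0, hpi, hs⟩ := geo_angle hp ha h1 h2
  have hp' : p ⬝ᵥ p = 1 := hp
  intro h
  have hd : geo p a ρ ⬝ᵥ p = -1 := by rw [h, neg_dotProduct, hp']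
  have : Real.cos (ρ * Real.arccos (p ⬝ᵥ a)) = -1 := by
    rw [← hd]
    simp only [geo, if_neg h1]
    simp only [add_dotProduct, smul_dotProduct, smul_eq_mul]
    rw [hp', dotProduct_comm a p]
    nth_rewrite 6 [← hc]
    set θ := Real.arccos (p ⬝ᵥ a)
    have es : Real.sin ((1 - ρ) * θ) = Real.sin θ * Real.cos (ρ * θ) -
      Real.cos θ * Real.sin (ρ * θ) := by
      rw [← Real.sin_sub]; congr 1; ring
    rw [es]
    field_simp
    ring
  have hl : ρ * Real.arccos (p ⬝ᵥ a) < Real.pi := by nlinarith [hρ.1, hρ.2]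
  have := Real.cos_lt_cos_of_nonneg_of_le_pi (mul_nonneg hρ.1 h0.le) le_rfl hl
  rw [Real.cos_pi] at this
  linarith

theorem dot_cont {X : Type*} [TopologicalSpace X] {S : Set X} {f g : X → V3}
    (hf : ContinuousOn f S) (hg : ContinuousOn g S) : ContinuousOn (fun x => f x ⬝ᵥ g x) S := by
  have e : (fun x => f x ⬝ᵥ g x) = fun x => f x 0 * g x 0 + f x 1 * g x 1 + f x 2 * g x 2 := by
    ext x; simp [dotProduct, Fin.sum_univ_three]
  rw [e]
  have hf' := continuousOn_pi.1 hf
  have hg' := continuousOn_pi.1 hg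
  exact (((hf' 0).mul (hg' 0)).add ((hf' 1).mul (hg' 1))).add ((hf' 2).mul (hg' 2))

theorem geo_cont {p : V3} (hp : p ∈ sphereS) {v : ℝ → V3} (hv : Continuous v)
    (hm : ∀ φ, v φ ∈ sphereS) (h1 : ∀ φ, p ≠ v φ) (h2 : ∀ φ, -p ≠ v φ) :
    Continuous fun q : ℝ × ℝ => geo p (v q.2) q.1 := by
  have hv2 : Continuous fun q : ℝ × ℝ => v q.2 := hv.comp continuous_snd
  have hθ : Continuous fun q : ℝ × ℝ => Real.arccos (p ⬝ᵥ v q.2) := by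
    refine Real.continuous_arccos.comp ?_
    have := dot_cont (S := univ) (f := fun _ : ℝ × ℝ => p) continuousOn_const hv2.continuousOn
    exact continuousOn_univ.1 this
  have hs : ∀ q : ℝ × ℝ, Real.sin (Real.arccos (p ⬝ᵥ v q.2)) ≠ 0 := fun q =>
    (geo_angle hp (hm q.2) (h1 q.2) (h2 q.2)).2.2.2.ne'
  have e : (fun q : ℝ × ℝ => geo p (v q.2) q.1) = fun q : ℝ × ℝ =>
      (Real.sin ((1 - q.1) * Real.arccos (p ⬝ᵥ v q.2)) / Real.sin (Real.arccos (p ⬝ᵥ v q.2))) • p +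
      (Real.sin (q.1 * Real.arccos (p ⬝ᵥ v q.2)) / Real.sin (Real.arccos (p ⬝ᵥ v q.2))) • v q.2 := by
    ext1 q
    simp only [geo, if_neg (h1 q.2)]
  rw [e]
  have hs' := Real.continuous_sin.comp hθ
  have a1 := (Real.continuous_sin.comp ((continuous_const.sub continuous_fst).mul hθ :
    Continuous fun q : ℝ × ℝ => (1 - q.1) * Real.arccos (p ⬝ᵥ v q.2))).div hs' hs
  have a2 := (Real.continuous_sin.comp (continuous_fst.mul hθ :
    Continuous fun q : ℝ × ℝ => q.1 * Real.arccos (p ⬝ᵥ v q.2))).div hs' hs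
  exact (a1.smul continuous_const).add (a2.smul hv2)

theorem wrap_deg {deg : (V3 → V3) → ℤ} (hd : DegreeTheory deg) {s : V3} (hs : s ∈ sphereS)
    {R : V3 → V3} (hR : Continuous R) (hRm : MapsTo R sphereS sphereS)
    (hRs : ∀ x, R x = npole → x = s)
    (hRd : ∀ f : V3 → V3, ContinuousOn f sphereS → MapsTo f sphereS sphereS →
      deg f = deg (fun x => R (f x)))
    {K : Set V3} (hK : Convex ℝ K) {n : V3 → V3} (hn : ContinuousOn n K)
    (hnS : ∀ x ∈ K, n x ∈ sphereS) {Ψ : V3 → ℂ × ℂ} (hΨ : ContinuousOn Ψ K)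
    (hΨl : ∀ x ∈ K, LiftS (R (n x)) (Ψ x)) {z : ℝ → V3} (hz : Continuous z)
    (hzp : ∀ φ, z (φ + 2 * Real.pi) = z φ) (hzK : ∀ φ, z φ ∈ K) {ctr : V3} (hctr : ctr ∈ K)
    (h1 : ∀ φ, n (z φ) ≠ s) (h2 : ∀ φ, n (z φ) ≠ -s) {k : ℤ}
    (hk : HW (fun ω => (Ψ (z (Complex.arg ω))).1) k) : deg (wrapMap n z ctr s) = k := by
  have hzpi : z (-Real.pi) = z Real.pi := by
    rw [← hzp (-Real.pi)]; congr 1; ring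
  have hs' := neg_mem_sphereS hs
  have hv : Continuous fun φ => n (z φ) := hn.comp_continuous hz hzK
  have g1 : ∀ φ, -s ≠ n (z φ) := fun φ => (h2 φ).symm
  have g2 : ∀ φ, -(-s) ≠ n (z φ) := fun φ => by rw [neg_neg]; exact (h1 φ).symm
  have hvm : ∀ φ, n (z φ) ∈ sphereS := fun φ => hnS _ (hzK φ)
  let Y : ℂ → V3 := fun ζ => ‖ζ‖ • z (Complex.arg ζ) + (1 - ‖ζ‖) • ctr
  let G : ℂ → V3 := fun ζ => geo (-s) (n (z (Complex.arg ζ))) ‖ζ‖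
  have hY : ContinuousOn Y (Metric.closedBall 0 1) := by
    refine aux_polar (fun ρ φ => ρ • z φ + (1 - ρ) • ctr) ?_ ?_ ?_
    · apply Continuous.continuousOn
      have := hz.comp (continuous_snd : Continuous fun q : ℝ × ℝ => q.2)
      exact (continuous_fst.smul this).add ((continuous_const.sub continuous_fst).smul
        continuous_const)
    · intro ρ; simp only [hzpi]
    · intro φ ψ; simp
  have hG : ContinuousOn G (Metric.closedBall 0 1) := by
    refine aux_polar (fun ρ φ => geo (-s) (n (z φ)) ρ) ?_ ?_ ?_
    · exact (geo_cont hs' hv hvm g1 g2).continuousOn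
    · intro ρ; simp only [hzpi]
    · intro φ ψ
      rw [geo_zero hs' (hvm _) (g1 _) (g2 _), geo_zero hs' (hvm _) (g1 _) (g2 _)]
  have hYK : ∀ ζ ∈ Metric.closedBall (0 : ℂ) 1, Y ζ ∈ K := by
    intro ζ hζ
    rw [mem_closedBall_zero_iff] at hζ
    exact hK (hzK _) hctr (norm_nonneg _) (by linarith) (by ring)
  have hw1 : ∀ x : V3, 0 ≤ x 2 → wrapMap n z ctr s x = n (Y (zc x)) := by
    intro x hx
    simp only [wrapMap, if_pos hx, Y, zc_norm]
    rfl
  have hw2 : ∀ x : V3, ¬ 0 ≤ x 2 → wrapMap n z ctr s x = G (zc x) := by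
    intro x hx
    simp only [wrapMap, if_neg hx, G, zc_norm]
    rfl
  have hYc : ∀ ω ∈ Metric.sphere (0 : ℂ) 1, Y ω = z (Complex.arg ω) := by
    intro ω hω
    rw [mem_sphere_zero_iff_norm] at hω
    simp [Y, hω]
  have heq : ∀ x ∈ sphereS, x 2 = 0 → n (Y (zc x)) = G (zc x) := by
    intro x hx h
    have hω := zc_mem_sphere hx h
    rw [hYc _ hω]
    rw [mem_sphere_zero_iff_norm] at hω
    simp only [G]
    rw [hω, geo_one hs' (hvm _) (g1 _) (g2 _)]
  have hw3 : ∀ x ∈ sphereS, x 2 ≤ 0 → wrapMap n z ctr s x = G (zc x) := by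
    intro x hx h
    by_cases h' : 0 ≤ x 2
    · rw [hw1 x h', heq x hx (le_antisymm h h')]
    · exact hw2 x h'
  have hGm : ∀ ζ, G ζ ∈ sphereS := fun ζ => geo_mem hs' (hvm _) (g1 _) (g2 _) _
  have hGs : ∀ ζ ∈ Metric.closedBall (0 : ℂ) 1, G ζ ≠ s := by
    intro ζ hζ
    rw [mem_closedBall_zero_iff] at hζ
    have := geo_ne hs' (hvm (Complex.arg ζ)) (g1 _) (g2 _) (ρ := ‖ζ‖) ⟨norm_nonneg _, hζ⟩
    rwa [neg_neg] at this
  have hwm : MapsTo (wrapMap n z ctr s) sphereS sphereS := by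
    intro x hx
    by_cases h : 0 ≤ x 2
    · rw [hw1 x h]; exact hnS _ (hYK _ (zc_mem_ball hx))
    · rw [hw2 x h]; exact hGm _
  have hwc : ContinuousOn (wrapMap n z ctr s) sphereS := by
    have e : sphereS = (sphereS ∩ {x | 0 ≤ x 2}) ∪ (sphereS ∩ {x | x 2 ≤ 0}) := by
      rw [← inter_union_distrib_left]
      ext x
      simp only [mem_inter_iff, mem_union, Set.mem_ofPred_eq]
      exact ⟨fun h => ⟨h, le_total _ _⟩, fun h => h.1⟩
    rw [e]
    refine ContinuousOn.union_of_isClosed ?_ ?_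
      (sphereS_closed.inter (isClosed_le continuous_const (continuous_apply 2)))
      (sphereS_closed.inter (isClosed_le (continuous_apply 2) continuous_const))
    · have c1 : ContinuousOn (fun x => Y (zc x)) (sphereS ∩ {x | 0 ≤ x 2}) :=
        hY.comp zc_cont.continuousOn fun x hx => zc_mem_ball hx.1
      have c2 := hn.comp c1 fun x hx => hYK _ (zc_mem_ball hx.1)
      exact c2.congr fun x hx => hw1 x hx.2
    · have c1 : ContinuousOn (fun x => G (zc x)) (sphereS ∩ {x | x 2 ≤ 0}) :=
        hG.comp zc_cont.continuousOn fun x hx => zc_mem_ball hx.1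
      exact c1.congr fun x hx => hw3 x hx.1 hx.2
  rw [hRd _ hwc hwm]
  refine nice_deg hd ⟨hR.comp_continuousOn hwc, fun x hx => hRm (hwm hx), ?_,
    fun ζ => Ψ (Y ζ), hΨ.comp hY hYK, fun ζ hζ => (hΨl _ (hYK ζ hζ)).1, ?_, ?_⟩
  · intro x hx h he
    have := hRs _ he
    rw [hw3 x hx h] at this
    exact hGs _ (zc_mem_ball hx) this
  · intro x hx h
    simp only []
    rw [hw1 x h, (hΨl _ (hYK _ (zc_mem_ball hx))).hopf]
  · exact hk.congr fun ω hω => by simp only [hYc ω hω]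

/-! ### Radial projection onto the frontier of a convex body -/

/-- The translate of `K` moving `o` to the origin. -/
def shiftK (K : Set V3) (o : V3) : Set V3 := (fun y => o + y) ⁻¹' K

def radp (K : Set V3) (o y : V3) : V3 := o + (gauge (shiftK K o) y)⁻¹ • y

theorem shiftK_convex {K : Set V3} (hc : Convex ℝ K) (o : V3) : Convex ℝ (shiftK K o) :=
  hc.translate_preimage_right o

theorem shiftK_nhds {K : Set V3} {o : V3} (ho : o ∈ interior K) : shiftK K o ∈ nhds (0 : V3) := by
  have h : K ∈ nhds (o + 0) := by rw [add_zero]; exact mem_interior_iff_mem_nhds.1 ho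
  exact (continuous_const.add continuous_id).continuousAt.preimage_mem_nhds h

theorem shiftK_frontier (K : Set V3) (o y : V3) :
    y ∈ frontier (shiftK K o) ↔ o + y ∈ frontier K := by
  have := (Homeomorph.addLeft o).preimage_frontier K
  rw [shiftK, show (fun y => o + y) ⁻¹' K = (Homeomorph.addLeft o) ⁻¹' K from rfl, ← this]
  rfl

theorem shiftK_pos {K : Set V3} (hK : IsCompact K) {o : V3} (ho : o ∈ interior K) {y : V3}
    (hy : y ≠ 0) : 0 < gauge (shiftK K o) y := by
  have hcomp : IsCompact (shiftK K o) :=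
    (Homeomorph.addLeft o).isClosedEmbedding.isCompact_preimage hK
  exact (gauge_pos (absorbent_nhds_zero (shiftK_nhds ho))
    (NormedSpace.isVonNBounded_of_isBounded ℝ hcomp.isBounded)).2 hy

theorem gauge_contK {K : Set V3} (hc : Convex ℝ K) {o : V3} (ho : o ∈ interior K) :
    Continuous (gauge (shiftK K o)) :=
  continuous_gauge (shiftK_convex hc o) (shiftK_nhds ho)

theorem radp_frontier {K : Set V3} (hK : IsCompact K) (hc : Convex ℝ K) {o : V3}
    (ho : o ∈ interior K) {y : V3} (hy : y ≠ 0) : radp K o y ∈ frontier K := by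
  have hp := shiftK_pos hK ho hy
  rw [radp, ← shiftK_frontier, ← gauge_eq_one_iff_mem_frontier (shiftK_convex hc o)
    (shiftK_nhds ho), gauge_smul_of_nonneg (inv_nonneg.2 hp.le), smul_eq_mul,
    inv_mul_cancel₀ hp.ne']

theorem radp_eq {K : Set V3} (hc : Convex ℝ K) {o : V3}
    (ho : o ∈ interior K) {x y : V3} {r : ℝ} (hr : 0 < r) (hx : x ∈ frontier K)
    (h : x = o + r • y) : radp K o y = x := by
  have h1 : gauge (shiftK K o) (r • y) = 1 := by
    rw [gauge_eq_one_iff_mem_frontier (shiftK_convex hc o) (shiftK_nhds ho), shiftK_frontier, ← h]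
    exact hx
  rw [gauge_smul_of_nonneg hr.le, smul_eq_mul] at h1
  rw [radp, h]
  congr 2
  exact (eq_inv_of_mul_eq_one_left h1).symm

theorem radp_cont {K : Set V3} (hK : IsCompact K) (hc : Convex ℝ K) {o : V3}
    (ho : o ∈ interior K) : ContinuousOn (radp K o) {y | y ≠ 0} := by
  have h1 := (gauge_contK hc ho).continuousOn (s := {y | y ≠ 0})
  have h2 := h1.inv₀ fun y hy => (shiftK_pos hK ho hy).ne'
  have h3 := h2.smul (continuousOn_id (s := {y : V3 | y ≠ 0}))
  have h4 := (continuousOn_const (c := o) (s := {y : V3 | y ≠ 0})).add h3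
  exact h4

/-! ### Frames -/

theorem dot3 (x y : V3) : x ⬝ᵥ y = x 0 * y 0 + x 1 * y 1 + x 2 * y 2 := by
  simp [dotProduct, Fin.sum_univ_three]

theorem cross0 (x y : V3) : (crossProduct x y) 0 = x 1 * y 2 - x 2 * y 1 := by
  simp [cross_apply]
theorem cross1 (x y : V3) : (crossProduct x y) 1 = x 2 * y 0 - x 0 * y 2 := by
  simp [cross_apply]
theorem cross2 (x y : V3) : (crossProduct x y) 2 = x 0 * y 1 - x 1 * y 0 := by
  simp [cross_apply]

/-- An oriented orthonormal frame. -/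
structure OFrame (e₁ e₂ N : V3) : Prop where
  e11 : e₁ ⬝ᵥ e₁ = 1
  e22 : e₂ ⬝ᵥ e₂ = 1
  e12 : e₁ ⬝ᵥ e₂ = 0
  cr : crossProduct e₁ e₂ = N

theorem OFrame.e1N {e₁ e₂ N : V3} (h : OFrame e₁ e₂ N) : e₁ ⬝ᵥ N = 0 := by
  rw [← h.cr]; simp only [dot3, cross0, cross1, cross2]; ring

theorem OFrame.e2N {e₁ e₂ N : V3} (h : OFrame e₁ e₂ N) : e₂ ⬝ᵥ N = 0 := by
  rw [← h.cr]; simp only [dot3, cross0, cross1, cross2]; ring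

theorem OFrame.NN {e₁ e₂ N : V3} (h : OFrame e₁ e₂ N) : N ⬝ᵥ N = 1 := by
  have a := h.e11
  have b := h.e22
  have c := h.e12
  rw [← h.cr]
  rw [dot3] at a b c
  simp only [dot3, cross0, cross1, cross2]
  have : (e₁ 0 * e₁ 0 + e₁ 1 * e₁ 1 + e₁ 2 * e₁ 2) * (e₂ 0 * e₂ 0 + e₂ 1 * e₂ 1 + e₂ 2 * e₂ 2) -
    (e₁ 0 * e₂ 0 + e₁ 1 * e₂ 1 + e₁ 2 * e₂ 2) ^ 2 = 1 := by rw [a, b, c]; ring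
  linear_combination this

theorem OFrame.expand {e₁ e₂ N : V3} (h : OFrame e₁ e₂ N) (w : V3) :
    w = (w ⬝ᵥ e₁) • e₁ + (w ⬝ᵥ e₂) • e₂ + (w ⬝ᵥ N) • N := by
  have a := h.e11
  have b := h.e22
  have c := h.e12
  have key : ∀ i, w i * ((e₁ ⬝ᵥ e₁) * (e₂ ⬝ᵥ e₂) - (e₁ ⬝ᵥ e₂) ^ 2) =
      (w ⬝ᵥ crossProduct e₁ e₂) * (crossProduct e₁ e₂) i +
      ((w ⬝ᵥ e₁) * (e₂ ⬝ᵥ e₂) - (w ⬝ᵥ e₂) * (e₁ ⬝ᵥ e₂)) * e₁ i +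
      ((w ⬝ᵥ e₂) * (e₁ ⬝ᵥ e₁) - (w ⬝ᵥ e₁) * (e₁ ⬝ᵥ e₂)) * e₂ i := by
    intro i
    fin_cases i
    · simp only [dot3, cross0, cross1, cross2, Fin.zero_eta]; ring
    · simp only [dot3, cross0, cross1, cross2, Fin.mk_one]; ring
    · simp only [dot3, cross0, cross1, cross2, Fin.reduceFinMk]; ring
  rw [a, b, c, h.cr] at key
  ext i
  have := key i
  simp only [Pi.add_apply, Pi.smul_apply, smul_eq_mul]
  linear_combination this

/-- Point of the plane spanned by `e₁, e₂`. -/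
def pl (e₁ e₂ : V3) (ω : ℂ) : V3 := ω.re • e₁ + ω.im • e₂

theorem pl_cont (e₁ e₂ : V3) : Continuous (pl e₁ e₂) :=
  (Complex.continuous_re.smul continuous_const).add (Complex.continuous_im.smul continuous_const)

/-- Coordinates in the plane spanned by `e₁, e₂`. -/
def co (e₁ e₂ y : V3) : ℂ := ⟨y ⬝ᵥ e₁, y ⬝ᵥ e₂⟩

theorem co_eq (e₁ e₂ y : V3) : co e₁ e₂ y =
    ((y ⬝ᵥ e₁ : ℝ) : ℂ) + ((y ⬝ᵥ e₂ : ℝ) : ℂ) * Complex.I := by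
  apply Complex.ext <;> simp [co]

theorem co_cont (e₁ e₂ : V3) : Continuous (co e₁ e₂) := by
  have : co e₁ e₂ = fun y => ((y ⬝ᵥ e₁ : ℝ) : ℂ) + ((y ⬝ᵥ e₂ : ℝ) : ℂ) * Complex.I :=
    funext (co_eq e₁ e₂)
  rw [this]
  simp only [dot3]
  fun_prop

theorem co_add (e₁ e₂ x y : V3) : co e₁ e₂ (x + y) = co e₁ e₂ x + co e₁ e₂ y := by
  apply Complex.ext <;> simp [co]

theorem co_smul (e₁ e₂ y : V3) (r : ℝ) : co e₁ e₂ (r • y) = (r : ℂ) * co e₁ e₂ y := by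
  apply Complex.ext <;> simp [co]

theorem OFrame.co_pl {e₁ e₂ N : V3} (h : OFrame e₁ e₂ N) (ω : ℂ) : co e₁ e₂ (pl e₁ e₂ ω) = ω := by
  apply Complex.ext
  · simp [co, pl, h.e11, dotProduct_comm e₂ e₁, h.e12]
  · simp [co, pl, h.e22, h.e12]

theorem OFrame.pl_N {e₁ e₂ N : V3} (h : OFrame e₁ e₂ N) (ω : ℂ) : pl e₁ e₂ ω ⬝ᵥ N = 0 := by
  simp [pl, h.e1N, h.e2N]

theorem OFrame.pl_co {e₁ e₂ N : V3} (h : OFrame e₁ e₂ N) {y : V3} (hy : y ⬝ᵥ N = 0) :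
    pl e₁ e₂ (co e₁ e₂ y) = y := by
  have := h.expand y
  rw [hy, zero_smul, add_zero] at this
  exact this.symm

theorem OFrame.pl_ne {e₁ e₂ N : V3} (h : OFrame e₁ e₂ N) {ω : ℂ} (hω : ω ≠ 0) : pl e₁ e₂ ω ≠ 0 := by
  intro h0
  have := h.co_pl ω
  rw [h0] at this
  apply hω
  rw [← this]
  apply Complex.ext <;> simp [co]

theorem pl_smul (e₁ e₂ : V3) (r : ℝ) (ω : ℂ) : pl e₁ e₂ ((r : ℂ) * ω) = r • pl e₁ e₂ ω := by
  simp [pl, smul_add, smul_smul]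

/-- The oblique projection determinant. -/
theorem frm_det {e₁ e₂ N f₁ f₂ M y : V3} (h : OFrame e₁ e₂ N) (h' : OFrame f₁ f₂ M) (hD : y ⬝ᵥ N ≠ 0) :
    let L : V3 → ℂ := fun x => co e₁ e₂ (x - ((x ⬝ᵥ N) / (y ⬝ᵥ N)) • y)
    (L f₁).re * (L f₂).im - (L f₁).im * (L f₂).re = (y ⬝ᵥ M) / (y ⬝ᵥ N) := by
  intro L
  have hN := h.NN
  rw [eq_div_iff hD]
  obtain ⟨s, hs⟩ : ∃ s, s = (f₁ ⬝ᵥ N) / (y ⬝ᵥ N) := ⟨_, rfl⟩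
  obtain ⟨t, ht⟩ : ∃ t, t = (f₂ ⬝ᵥ N) / (y ⬝ᵥ N) := ⟨_, rfl⟩
  have hs' : s * (y ⬝ᵥ N) = f₁ ⬝ᵥ N := by rw [hs, div_mul_cancel₀ _ hD]
  have ht' : t * (y ⬝ᵥ N) = f₂ ⬝ᵥ N := by rw [ht, div_mul_cancel₀ _ hD]
  simp only [L, co]
  rw [← hs, ← ht]
  have k1 : ∀ p q : V3, (p ⬝ᵥ e₁) * (q ⬝ᵥ e₂) - (p ⬝ᵥ e₂) * (q ⬝ᵥ e₁) =
      crossProduct p q ⬝ᵥ crossProduct e₁ e₂ := by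
    intro p q
    simp only [dot3, cross0, cross1, cross2]; ring
  rw [k1, h.cr]
  have k2 : crossProduct (f₁ - s • y) (f₂ - t • y) ⬝ᵥ N =
      crossProduct f₁ f₂ ⬝ᵥ N - t * (crossProduct f₁ y ⬝ᵥ N) - s * (crossProduct y f₂ ⬝ᵥ N) := by
    simp only [dot3, cross0, cross1, cross2, Pi.sub_apply, Pi.smul_apply, smul_eq_mul]; ring
  have k3 : (crossProduct f₁ f₂ ⬝ᵥ N) * (y ⬝ᵥ N) - (f₂ ⬝ᵥ N) * (crossProduct f₁ y ⬝ᵥ N) -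
      (f₁ ⬝ᵥ N) * (crossProduct y f₂ ⬝ᵥ N) = (y ⬝ᵥ crossProduct f₁ f₂) * (N ⬝ᵥ N) := by
    simp only [dot3, cross0, cross1, cross2]; ring
  rw [hN, h'.cr] at k3
  rw [h'.cr] at k2
  rw [k2]
  linear_combination k3 - (crossProduct f₁ y ⬝ᵥ N) * ht' - (crossProduct y f₂ ⬝ᵥ N) * hs'



def ht (c N x : V3) : ℝ := (x - c) ⬝ᵥ N

theorem ht_cont (c N : V3) : Continuous (ht c N) := by
  unfold ht
  simp only [dot3]
  fun_prop

theorem ht_line (c N p q : V3) (t : ℝ) :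
    ht c N (p + t • (q - p)) = (1 - t) * ht c N p + t * ht c N q := by
  simp only [ht, dot3, Pi.add_apply, Pi.sub_apply, Pi.smul_apply, smul_eq_mul]
  ring

theorem ht_self (c N : V3) : ht c N c = 0 := by simp [ht]

/-- The linear map with kernel spanned by `y` which is the coordinate map on the plane. -/
def obl (e₁ e₂ N y x : V3) : ℂ := co e₁ e₂ (x - ((x ⬝ᵥ N) / (y ⬝ᵥ N)) • y)

theorem obl_add (e₁ e₂ N y p q : V3) :
    obl e₁ e₂ N y (p + q) = obl e₁ e₂ N y p + obl e₁ e₂ N y q := by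
  rw [obl, obl, obl, ← co_add, add_dotProduct, add_div, add_smul]
  congr 1
  abel

theorem obl_smul (e₁ e₂ N y p : V3) (r : ℝ) :
    obl e₁ e₂ N y (r • p) = (r : ℂ) * obl e₁ e₂ N y p := by
  rw [obl, obl, ← co_smul, smul_dotProduct, smul_sub, smul_smul, smul_eq_mul, mul_div_assoc]

theorem obl_self {e₁ e₂ N y : V3} (h : y ⬝ᵥ N ≠ 0) : obl e₁ e₂ N y y = 0 := by
  rw [obl, div_self h, one_smul, sub_self]
  apply Complex.ext <;> simp [co]

theorem obl_cont (e₁ e₂ N y : V3) : Continuous (obl e₁ e₂ N y) := by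
  have h : Continuous fun x : V3 => x - ((x ⬝ᵥ N) / (y ⬝ᵥ N)) • y := by
    simp only [dot3]
    fun_prop
  exact (co_cont e₁ e₂).comp h

theorem obl_zero {e₁ e₂ N y x : V3} (h : OFrame e₁ e₂ N) (hD : y ⬝ᵥ N ≠ 0)
    (h0 : obl e₁ e₂ N y x = 0) : x = ((x ⬝ᵥ N) / (y ⬝ᵥ N)) • y := by
  have h1 : (x - ((x ⬝ᵥ N) / (y ⬝ᵥ N)) • y) ⬝ᵥ N = 0 := by
    rw [sub_dotProduct, smul_dotProduct, smul_eq_mul, div_mul_cancel₀ _ hD, sub_self]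
  have h2 := h.pl_co h1
  rw [show co e₁ e₂ (x - ((x ⬝ᵥ N) / (y ⬝ᵥ N)) • y) = 0 from h0] at h2
  have h3 : pl e₁ e₂ 0 = 0 := by simp [pl]
  rw [h3] at h2
  exact (sub_eq_zero.1 h2.symm)

/-- A convex body with disjoint cleaving planes. -/
structure TruncBody {m : ℕ} (K : Set V3) (N ctr e1 e2 : Fin m → V3) : Prop where
  cpt : IsCompact K
  cvx : Convex ℝ K
  frame : ∀ a, OFrame (e1 a) (e2 a) (N a)
  ctr_int : ∀ a, ctr a ∈ interior K
  ctr_neg : ∀ a b, b ≠ a → ht (ctr b) (N b) (ctr a) < 0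
  cleave : ∀ a b, ∀ x ∈ K, ht (ctr a) (N a) x = 0 → ht (ctr b) (N b) x ≤ 0
  excl : ∀ a b, a ≠ b → ∀ x ∈ K, 0 ≤ ht (ctr a) (N a) x → 0 ≤ ht (ctr b) (N b) x →
    ht (ctr a) (N a) x = 0 ∧ ht (ctr b) (N b) x = 0

/-- The boundary loop of the cleaved face. -/
def bt (K : Set V3) (e₁ e₂ o : V3) (ω : ℂ) : V3 := radp K o (pl e₁ e₂ ω)

section TruncSec

variable {m : ℕ} {K : Set V3} {N ctr e1 e2 : Fin m → V3}

theorem TruncBody.bt_cont (T : TruncBody K N ctr e1 e2) (a : Fin m) :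
    ContinuousOn (bt K (e1 a) (e2 a) (ctr a)) (Metric.sphere 0 1) := by
  have h := (radp_cont T.cpt T.cvx (T.ctr_int a)).comp
    ((pl_cont (e1 a) (e2 a)).continuousOn (s := Metric.sphere (0 : ℂ) 1))
    (fun ω hω => (T.frame a).pl_ne (aux_sphere_ne hω))
  exact h

theorem TruncBody.bt_fr (T : TruncBody K N ctr e1 e2) (a : Fin m) {ω : ℂ}
    (hω : ω ∈ Metric.sphere (0 : ℂ) 1) : bt K (e1 a) (e2 a) (ctr a) ω ∈ frontier K :=
  radp_frontier T.cpt T.cvx (T.ctr_int a) ((T.frame a).pl_ne (aux_sphere_ne hω))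

theorem TruncBody.bt_ht (T : TruncBody K N ctr e1 e2) (a : Fin m) (ω : ℂ) :
    ht (ctr a) (N a) (bt K (e1 a) (e2 a) (ctr a) ω) = 0 := by
  rw [ht, bt, radp, add_sub_cancel_left, smul_dotProduct, (T.frame a).pl_N, smul_zero]

theorem TruncBody.fr_sub (T : TruncBody K N ctr e1 e2) {x : V3} (hx : x ∈ frontier K) : x ∈ K :=
  T.cpt.isClosed.frontier_subset hx

theorem TruncBody.bt_co (T : TruncBody K N ctr e1 e2) (a : Fin m) {x : V3} (hx : x ∈ frontier K)
    (h : ht (ctr a) (N a) x = 0) :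
    co (e1 a) (e2 a) (x - ctr a) ≠ 0 ∧
    bt K (e1 a) (e2 a) (ctr a) (((‖co (e1 a) (e2 a) (x - ctr a)‖⁻¹ : ℝ) : ℂ) *
      co (e1 a) (e2 a) (x - ctr a)) = x := by
  have h1 := (T.frame a).pl_co h
  have hne : co (e1 a) (e2 a) (x - ctr a) ≠ 0 := by
    intro h0
    rw [h0] at h1
    have h3 : pl (e1 a) (e2 a) 0 = 0 := by simp [pl]
    rw [h3] at h1
    have h4 : x = ctr a := (sub_eq_zero.1 h1.symm)
    rw [h4] at hx
    exact hx.2 (T.ctr_int a)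
  refine ⟨hne, ?_⟩
  have hpos : 0 < ‖co (e1 a) (e2 a) (x - ctr a)‖ := norm_pos_iff.2 hne
  refine radp_eq T.cvx (T.ctr_int a) hpos hx ?_
  rw [pl_smul, smul_smul, mul_inv_cancel₀ hpos.ne', one_smul, h1]
  abel

theorem TruncBody.line (T : TruncBody K N ctr e1 e2) {a0 b : Fin m} (hb : b ≠ a0) {x : V3}
    (h1 : ht (ctr a0) (N a0) x ≤ 0)
    (hb1 : ht (ctr b) (N b) x ≤ 0)
    (h0 : obl (e1 a0) (e2 a0) (N a0) (ctr b - ctr a0) (x - ctr a0) = 0) :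
    ∃ t : ℝ, 0 ≤ t ∧ t ≤ 1 ∧ x = ctr a0 + t • (ctr b - ctr a0) := by
  have hD : (ctr b - ctr a0) ⬝ᵥ N a0 < 0 := T.ctr_neg b a0 hb.symm
  have h2 := obl_zero (T.frame a0) hD.ne h0
  have h3 : x = ctr a0 +
      ((x - ctr a0) ⬝ᵥ N a0 / (ctr b - ctr a0) ⬝ᵥ N a0) • (ctr b - ctr a0) := by
    rw [← h2]; abel
  have h4 : 0 ≤ (x - ctr a0) ⬝ᵥ N a0 / (ctr b - ctr a0) ⬝ᵥ N a0 := div_nonneg_of_nonpos h1 hD.le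
  generalize (x - ctr a0) ⬝ᵥ N a0 / (ctr b - ctr a0) ⬝ᵥ N a0 = t at h3 h4
  refine ⟨t, h4, ?_, h3⟩
  rw [h3, ht_line, ht_self, mul_zero, add_zero] at hb1
  have := T.ctr_neg a0 b hb
  by_contra hc
  push Not at hc
  nlinarith

theorem TruncBody.seg_int (T : TruncBody K N ctr e1 e2) (a b : Fin m) {t : ℝ} (h0 : 0 ≤ t) (h1 : t ≤ 1) :
    ctr a + t • (ctr b - ctr a) ∈ interior K :=
  T.cvx.interior.add_smul_sub_mem (T.ctr_int a) (T.ctr_int b) ⟨h0, h1⟩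

theorem TruncBody.tau_ne_fr (T : TruncBody K N ctr e1 e2) {a0 b : Fin m} (hb : b ≠ a0) {x : V3}
    (hx : x ∈ frontier K) (h1 : ht (ctr a0) (N a0) x ≤ 0) (hb1 : ht (ctr b) (N b) x ≤ 0) :
    obl (e1 a0) (e2 a0) (N a0) (ctr b - ctr a0) (x - ctr a0) ≠ 0 := by
  intro h0
  obtain ⟨t, t0, t1, rfl⟩ := T.line hb h1 hb1 h0
  exact hx.2 (T.seg_int a0 b t0 t1)

theorem TruncBody.tau_ne_C (T : TruncBody K N ctr e1 e2) {a0 a b : Fin m} (hb : b ≠ a0) (ha : a ≠ a0)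
    (hab : a ≠ b) {x : V3} (hx : x ∈ K) (h : ht (ctr a) (N a) x = 0) :
    obl (e1 a0) (e2 a0) (N a0) (ctr b - ctr a0) (x - ctr a0) ≠ 0 := by
  intro h0
  obtain ⟨t, t0, t1, rfl⟩ := T.line hb (T.cleave a a0 x hx h) (T.cleave a b x hx h) h0
  rw [ht_line] at h
  have i1 := T.ctr_neg a0 a ha
  have i2 := T.ctr_neg b a hab
  rcases eq_or_lt_of_le t0 with h3 | h3
  · subst h3; linarith
  · nlinarith [mul_nonneg (sub_nonneg.2 t1) (neg_nonneg.2 i1.le), mul_pos h3 (neg_pos.2 i2)]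

theorem TruncBody.HW_other (T : TruncBody K N ctr e1 e2) {a0 a b : Fin m} (hb : b ≠ a0) (ha : a ≠ a0)
    (hab : a ≠ b) : HW (fun ω => obl (e1 a0) (e2 a0) (N a0) (ctr b - ctr a0)
      (bt K (e1 a) (e2 a) (ctr a) ω - ctr a0)) 0 := by
  have hcl : IsClosed {x | ht (ctr a) (N a) x = 0} :=
    isClosed_eq (ht_cont _ _) continuous_const
  have hcv : Convex ℝ {x | ht (ctr a) (N a) x = 0} := by
    intro x hx y hy p q hp hq hpq
    simp only [Set.mem_ofPred_eq] at hx hy ⊢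
    have : p • x + q • y = x + q • (y - x) := by
      have hp' : p = 1 - q := by linarith
      rw [hp', sub_smul, one_smul, smul_sub]; abel
    rw [this, ht_line, hx, hy]; ring
  obtain ⟨L, hL, hLe⟩ := aux_log (T.cpt.inter_right hcl) (T.cvx.inter hcv)
    (fun x => obl (e1 a0) (e2 a0) (N a0) (ctr b - ctr a0) (x - ctr a0))
    ((obl_cont _ _ _ _).comp (continuous_id.sub continuous_const)).continuousOn
    (fun x hx => T.tau_ne_C hb ha hab hx.1 hx.2)
  have hm : MapsTo (bt K (e1 a) (e2 a) (ctr a)) (Metric.sphere 0 1)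
      (K ∩ {x | ht (ctr a) (N a) x = 0}) := fun ω hω => ⟨T.fr_sub (T.bt_fr a hω), T.bt_ht a ω⟩
  exact HW_exp _ (hL.comp (T.bt_cont a) hm) _ (fun ω hω => hLe _ (hm hω))

theorem TruncBody.HW_base (T : TruncBody K N ctr e1 e2) {a0 b : Fin m} :
    HW (fun ω => obl (e1 a0) (e2 a0) (N a0) (ctr b - ctr a0)
      (bt K (e1 a0) (e2 a0) (ctr a0) ω - ctr a0)) 1 := by
  have h1 := HW_pos (fun ω => (gauge (shiftK K (ctr a0)) (pl (e1 a0) (e2 a0) ω))⁻¹)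
    ((((gauge_contK T.cvx (T.ctr_int a0)).comp (pl_cont (e1 a0) (e2 a0))).continuousOn).inv₀
      (fun ω hω => (shiftK_pos T.cpt (T.ctr_int a0) ((T.frame a0).pl_ne (aux_sphere_ne hω))).ne'))
    (fun ω hω => inv_pos.2
      (shiftK_pos T.cpt (T.ctr_int a0) ((T.frame a0).pl_ne (aux_sphere_ne hω))))
  have h2 := h1.mul HW_id
  rw [zero_add] at h2
  refine h2.congr fun ω hω => ?_
  rw [bt, radp, add_sub_cancel_left, obl_smul, obl, (T.frame a0).pl_N, zero_div, zero_smul, sub_zero,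
    (T.frame a0).co_pl]

theorem TruncBody.HW_opp (T : TruncBody K N ctr e1 e2) {a0 b : Fin m} (hb : b ≠ a0) :
    HW (fun ω => obl (e1 a0) (e2 a0) (N a0) (ctr b - ctr a0)
      (bt K (e1 b) (e2 b) (ctr b) ω - ctr a0)) (-1) := by
  have hD : (ctr b - ctr a0) ⬝ᵥ N a0 < 0 := T.ctr_neg b a0 hb.symm
  have hM : 0 < (ctr b - ctr a0) ⬝ᵥ N b := by
    have : (ctr a0 - ctr b) ⬝ᵥ N b < 0 := T.ctr_neg a0 b hb
    rw [← neg_sub, neg_dotProduct]; linarith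
  have h1 := HW_pos (fun ω => (gauge (shiftK K (ctr b)) (pl (e1 b) (e2 b) ω))⁻¹)
    ((((gauge_contK T.cvx (T.ctr_int b)).comp (pl_cont (e1 b) (e2 b))).continuousOn).inv₀
      (fun ω hω => (shiftK_pos T.cpt (T.ctr_int b) ((T.frame b).pl_ne (aux_sphere_ne hω))).ne'))
    (fun ω hω => inv_pos.2
      (shiftK_pos T.cpt (T.ctr_int b) ((T.frame b).pl_ne (aux_sphere_ne hω))))
  have hdet := frm_det (T.frame a0) (T.frame b) hD.ne
  have h3 := HW_lin (obl (e1 a0) (e2 a0) (N a0) (ctr b - ctr a0) (e1 b))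
    (obl (e1 a0) (e2 a0) (N a0) (ctr b - ctr a0) (e2 b))
    (by
      have h4 : (ctr b - ctr a0) ⬝ᵥ N b / (ctr b - ctr a0) ⬝ᵥ N a0 < 0 := div_neg_of_pos_of_neg hM hD
      rw [← hdet] at h4
      exact h4)
  have h2 := h1.mul h3
  rw [zero_add] at h2
  refine h2.congr fun ω hω => ?_
  have he : bt K (e1 b) (e2 b) (ctr b) ω - ctr a0 = (ctr b - ctr a0) +
      (gauge (shiftK K (ctr b)) (pl (e1 b) (e2 b) ω))⁻¹ • pl (e1 b) (e2 b) ω := by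
    rw [bt, radp]; abel
  rw [he, obl_add, obl_self hD.ne, zero_add, obl_smul]
  congr 1
  rw [pl, obl_add, obl_smul, obl_smul]

end TruncSec


section TruncSum

variable {m : ℕ} {K : Set V3} {N ctr e1 e2 : Fin m → V3}

theorem TruncBody.ext_log (T : TruncBody K N ctr e1 e2) (a : Fin m) (W : V3 → ℂ)
    (h : HW (fun ω => W (bt K (e1 a) (e2 a) (ctr a) ω)) 0) :
    ∃ γ : V3 → ℂ, Continuous γ ∧
      ∀ x ∈ frontier K, ht (ctr a) (N a) x = 0 → W x = Complex.exp (γ x) := by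
  obtain ⟨g, hg, hge⟩ := h
  set A : Set V3 := frontier K ∩ {x | ht (ctr a) (N a) x = 0} with hA
  have hAc : IsClosed A := isClosed_frontier.inter (isClosed_eq (ht_cont _ _) continuous_const)
  set c : V3 → ℂ := fun x => co (e1 a) (e2 a) (x - ctr a) with hc
  have hcc : Continuous c := (co_cont _ _).comp (continuous_id.sub continuous_const)
  set q : V3 → ℂ := fun x => ((‖c x‖⁻¹ : ℝ) : ℂ) * c x with hq
  have hcne : ∀ x ∈ A, c x ≠ 0 := fun x hx => (T.bt_co a hx.1 hx.2).1
  have hqc : ContinuousOn q A := by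
    have h1 : ContinuousOn (fun x => ‖c x‖⁻¹) A :=
      hcc.norm.continuousOn.inv₀ fun x hx => (norm_pos_iff.2 (hcne x hx)).ne'
    exact (Complex.continuous_ofReal.comp_continuousOn h1).mul hcc.continuousOn
  have hqm : MapsTo q A (Metric.sphere 0 1) := by
    intro x hx
    have h1 := norm_pos_iff.2 (hcne x hx)
    rw [mem_sphere_zero_iff_norm, hq]
    simp only [norm_mul, Complex.norm_real, norm_inv, norm_norm]
    exact inv_mul_cancel₀ h1.ne'
  obtain ⟨γ, hγ, hγe⟩ := aux_tietze hAc (fun x => g (q x)) (hg.comp hqc hqm)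
  refine ⟨γ, hγ, fun x hx hx0 => ?_⟩
  have h1 := hge (q x) (hqm ⟨hx, hx0⟩)
  have h2 : bt K (e1 a) (e2 a) (ctr a) (q x) = x := (T.bt_co a hx hx0).2
  rw [hγe x ⟨hx, hx0⟩]
  simp only [zpow_zero, one_mul] at h1
  rw [h2] at h1
  exact h1

/-- The disc filling. -/
theorem TruncBody.disc (T : TruncBody K N ctr e1 e2) (a0 : Fin m) (U : V3 → ℂ)
    (hU : ContinuousOn U (frontier K ∩ {x | ht (ctr a0) (N a0) x ≤ 0}))
    (hne : ∀ x ∈ frontier K ∩ {x | ht (ctr a0) (N a0) x ≤ 0}, U x ≠ 0) :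
    HW (fun ω => U (bt K (e1 a0) (e2 a0) (ctr a0) ω)) 0 := by
  set y : ℂ → V3 := fun ζ => pl (e1 a0) (e2 a0) ζ - Real.sqrt (1 - ‖ζ‖ ^ 2) • N a0 with hy
  have hyc : Continuous y := by
    have h1 : Continuous fun ζ : ℂ => Real.sqrt (1 - ‖ζ‖ ^ 2) := by fun_prop
    exact (pl_cont _ _).sub (h1.smul continuous_const)
  have hF := T.frame a0
  have hyN : ∀ ζ, y ζ ⬝ᵥ N a0 = - Real.sqrt (1 - ‖ζ‖ ^ 2) := by
    intro ζ
    simp only [hy]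
    rw [sub_dotProduct, hF.pl_N, smul_dotProduct, hF.NN]; simp
  have hyne : ∀ ζ, y ζ ≠ 0 := by
    intro ζ h0
    have h1 := hyN ζ
    rw [h0, zero_dotProduct] at h1
    have h2 : Real.sqrt (1 - ‖ζ‖ ^ 2) = 0 := by linarith
    have h3 : pl (e1 a0) (e2 a0) ζ = 0 := by
      have := h0
      simp only [hy] at this
      rw [h2, zero_smul, sub_zero] at this
      exact this
    by_cases hz : ζ = 0
    · rw [hz] at h2; simp at h2
    · exact hF.pl_ne hz h3
  have hΦc : Continuous fun ζ => radp K (ctr a0) (y ζ) := by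
    rw [← continuousOn_univ]
    have := (radp_cont T.cpt T.cvx (T.ctr_int a0)).comp (hyc.continuousOn (s := univ))
      (fun ζ _ => hyne ζ)
    exact this
  have hΦm : ∀ ζ, radp K (ctr a0) (y ζ) ∈ frontier K ∩ {x | ht (ctr a0) (N a0) x ≤ 0} := by
    intro ζ
    refine ⟨radp_frontier T.cpt T.cvx (T.ctr_int a0) (hyne ζ), ?_⟩
    have hp := shiftK_pos T.cpt (T.ctr_int a0) (hyne ζ)
    simp only [Set.mem_ofPred_eq]
    rw [ht, radp, add_sub_cancel_left, smul_dotProduct, hyN, smul_eq_mul]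
    have := mul_nonneg (inv_pos.2 hp).le (Real.sqrt_nonneg (1 - ‖ζ‖ ^ 2))
    linarith
  have hcomp := hU.comp (hΦc.continuousOn (s := Metric.closedBall (0 : ℂ) 1)) (fun ζ _ => hΦm ζ)
  obtain ⟨L, hL, hLe⟩ := aux_log (isCompact_closedBall (0 : ℂ) 1) (convex_closedBall (0 : ℂ) 1)
    (fun ζ => U (radp K (ctr a0) (y ζ))) hcomp (fun ζ _ => hne _ (hΦm ζ))
  refine HW_exp L (hL.mono Metric.sphere_subset_closedBall) _ fun ω hω => ?_
  rw [← hLe ω (Metric.sphere_subset_closedBall hω)]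
  have h1 : y ω = pl (e1 a0) (e2 a0) ω := by
    simp only [hy]
    rw [mem_sphere_zero_iff_norm.1 hω]; simp
  simp only [h1, bt]

theorem TruncBody.sum_zero (T : TruncBody K N ctr e1 e2) (u : V3 → ℂ)
    (hu : ContinuousOn u (frontier K ∩ {x | ∀ a, ht (ctr a) (N a) x ≤ 0}))
    (hne : ∀ x ∈ frontier K ∩ {x | ∀ a, ht (ctr a) (N a) x ≤ 0}, u x ≠ 0)
    (k : Fin m → ℤ) (hk : ∀ a, HW (fun ω => u (bt K (e1 a) (e2 a) (ctr a) ω)) (k a)) :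
    ∑ a, k a = 0 := by
  rcases isEmpty_or_nonempty (Fin m) with hm | ⟨⟨a0⟩⟩
  · simp
  set G : Set V3 := frontier K ∩ {x | ∀ a, ht (ctr a) (N a) x ≤ 0} with hG
  have hGc : IsClosed G := by
    refine isClosed_frontier.inter ?_
    have : {x | ∀ a, ht (ctr a) (N a) x ≤ 0} = ⋂ a, {x | ht (ctr a) (N a) x ≤ 0} := by
      ext x; simp
    rw [this]
    exact isClosed_iInter fun a => isClosed_le (ht_cont _ _) continuous_const
  set S := Finset.univ.erase a0 with hS
  set τ : Fin m → V3 → ℂ := fun b x =>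
    obl (e1 a0) (e2 a0) (N a0) (ctr b - ctr a0) (x - ctr a0) with hτ
  have hτc : ∀ b, Continuous (τ b) := fun b =>
    (obl_cont _ _ _ _).comp (continuous_id.sub continuous_const)
  have hτn : ∀ b ∈ S, ∀ x ∈ G, τ b x ≠ 0 := fun b hb x hx =>
    T.tau_ne_fr (Finset.ne_of_mem_erase hb) hx.1 (hx.2 a0) (hx.2 b)
  set W : V3 → ℂ := fun x => u x * ∏ b ∈ S, τ b x ^ k b with hW
  have hWc : ContinuousOn W G := by
    refine hu.mul (continuousOn_finsetProd _ fun b hb => ?_)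
    exact (hτc b).continuousOn.zpow₀ _ fun x hx => Or.inl (hτn b hb x hx)
  have hWn : ∀ x ∈ G, W x ≠ 0 := fun x hx =>
    mul_ne_zero (hne x hx) (Finset.prod_ne_zero_iff.2 fun b hb => zpow_ne_zero _ (hτn b hb x hx))
  have hW0 : ∀ a, a ≠ a0 → HW (fun ω => W (bt K (e1 a) (e2 a) (ctr a) ω)) 0 := by
    intro a ha
    have h1 := (hk a).mul (HW.prod S (fun b ω => τ b (bt K (e1 a) (e2 a) (ctr a) ω) ^ k b)
      (fun b => if b = a then -k a else 0) (fun b hb => by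
        have hb' := Finset.ne_of_mem_erase hb
        by_cases hba : b = a
        · subst hba
          have := (T.HW_opp hb').zpow (k b)
          simp only [if_true]
          rw [neg_one_mul] at this
          exact this
        · have := (T.HW_other hb' ha (Ne.symm hba)).zpow (k b)
          simp only [if_neg hba]
          rw [zero_mul] at this
          exact this))
    have h2 : ∑ b ∈ S, (if b = a then -k a else 0) = -k a := by
      rw [Finset.sum_ite_eq' S a, if_pos (Finset.mem_erase.2 ⟨ha, Finset.mem_univ _⟩)]
    rw [h2, add_neg_cancel] at h1
    exact h1
  have hWs : HW (fun ω => W (bt K (e1 a0) (e2 a0) (ctr a0) ω)) (∑ a, k a) := by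
    have h1 := (hk a0).mul (HW.prod S (fun b ω => τ b (bt K (e1 a0) (e2 a0) (ctr a0) ω) ^ k b)
      (fun b => k b) (fun b hb => by
        have := (T.HW_base (a0 := a0) (b := b)).zpow (k b)
        rw [one_mul] at this
        exact this))
    rw [hS, Finset.add_sum_erase _ _ (Finset.mem_univ a0)] at h1
    exact h1
  have hγ : ∀ a, ∃ γ : V3 → ℂ, Continuous γ ∧ (a ≠ a0 →
      ∀ x ∈ frontier K, ht (ctr a) (N a) x = 0 → W x = Complex.exp (γ x)) := by
    intro a
    by_cases ha : a = a0
    · exact ⟨fun _ => 0, continuous_const, fun h => absurd ha h⟩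
    · obtain ⟨γ, h1, h2⟩ := T.ext_log a W (hW0 a ha)
      exact ⟨γ, h1, fun _ => h2⟩
  choose γ hγc hγe using hγ
  set A : Option (Fin m) → Set V3 := fun i => match i with
    | none => G
    | some a => if a = a0 then ∅ else frontier K ∩ {x | 0 ≤ ht (ctr a) (N a) x} with hA
  set F : Option (Fin m) → V3 → ℂ := fun i => match i with
    | none => W
    | some a => fun x => Complex.exp (γ a x) with hF
  have hAs : ∀ a x, x ∈ A (some a) → a ≠ a0 ∧ x ∈ frontier K ∧ 0 ≤ ht (ctr a) (N a) x := by
    intro a x hx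
    simp only [hA] at hx
    by_cases ha : a = a0
    · rw [if_pos ha] at hx; exact absurd hx (Set.notMem_empty _)
    · rw [if_neg ha] at hx; exact ⟨ha, hx.1, hx.2⟩
  have hAsc : ∀ a, IsClosed (A (some a)) := by
    intro a
    simp only [hA]
    split_ifs
    · exact isClosed_empty
    · exact isClosed_frontier.inter (isClosed_le continuous_const (ht_cont _ _))
  have hcomp : ∀ a, ∀ x ∈ G, x ∈ A (some a) → W x = Complex.exp (γ a x) := by
    intro a x hx hxa
    obtain ⟨h1, h2, h3⟩ := hAs a x hxa
    exact hγe a h1 x h2 (le_antisymm (hx.2 a) h3)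
  obtain ⟨U, hUc, hUe⟩ := aux_glue A
    (by rintro (_ | a); exacts [hGc, hAsc a]) F
    (by
      rintro (_ | a)
      · exact hWc
      · exact (Complex.continuous_exp.comp (hγc a)).continuousOn)
    (by
      rintro (_ | a) (_ | b) x hx hx'
      · rfl
      · exact hcomp b x hx hx'
      · exact (hcomp a x hx' hx).symm
      · by_cases hab : a = b
        · rw [hab]
        · obtain ⟨h1, h2, h3⟩ := hAs a x hx
          obtain ⟨h1', h2', h3'⟩ := hAs b x hx'
          obtain ⟨q1, q2⟩ := T.excl a b hab x (T.fr_sub h2) h3 h3'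
          exact (hγe a h1 x h2 q1).symm.trans (hγe b h1' x h2 q2))
  have hcov : ∀ x ∈ frontier K ∩ {x | ht (ctr a0) (N a0) x ≤ 0}, ∃ i, x ∈ A i := by
    intro x hx
    by_cases hall : ∀ a, ht (ctr a) (N a) x ≤ 0
    · exact ⟨none, hx.1, hall⟩
    · push Not at hall
      obtain ⟨a, ha⟩ := hall
      have haa : a ≠ a0 := by
        rintro rfl
        exact absurd hx.2 (not_le.2 ha)
      refine ⟨some a, ?_⟩
      simp only [hA]
      rw [if_neg haa]
      exact ⟨hx.1, ha.le⟩
  have hfin := T.disc a0 U (hUc.mono fun x hx => Set.mem_iUnion.2 (hcov x hx)) (by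
    intro x hx
    obtain ⟨i, hi⟩ := hcov x hx
    rw [hUe i x hi]
    rcases i with _ | a
    · exact hWn x hi
    · exact Complex.exp_ne_zero _)
  refine HW_zero hWs (hfin.congr fun ω hω => ?_)
  exact (hUe none _ ⟨T.bt_fr a0 hω, fun a => T.cleave a0 a _ (T.fr_sub (T.bt_fr a0 hω))
    (T.bt_ht a0 ω)⟩).symm

end TruncSum


/-! ### Application to truncated polyhedra -/

namespace PolyCtx

variable (P : PolyCtx)

theorem vert_mem (a : Fin P.nv) : P.vert a ∈ P.Pbar := by
  rw [P.hull]; exact subset_convexHull ℝ _ (Set.mem_range_self a)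

theorem excl_aux {a b : Fin P.nv} (hab : b ≠ a) {x : V3} (hx : x ∈ P.Pbar)
    (hb : 0 ≤ ht (P.cpt b) (P.Cnormal b) x) : ht (P.cpt a) (P.Cnormal a) x ≤ 0 := by
  by_contra hc
  push Not at hc
  have h1 : ht (P.cpt a) (P.Cnormal a) (P.vert b) < 0 := P.sep_other a b hab
  have h2 : 0 < ht (P.cpt b) (P.Cnormal b) (P.vert b) := P.sep_vert b
  set p := ht (P.cpt a) (P.Cnormal a) x with hp
  set q := ht (P.cpt a) (P.Cnormal a) (P.vert b) with hq
  have hpq : 0 < p - q := by linarith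
  have ht0 : 0 < p / (p - q) := div_pos hc hpq
  have ht1 : p / (p - q) ≤ 1 := by rw [div_le_one hpq]; linarith
  have hy : x + (p / (p - q)) • (P.vert b - x) ∈ P.Pbar :=
    P.convex.add_smul_sub_mem hx (P.vert_mem b) ⟨ht0.le, ht1⟩
  have hy0 : ht (P.cpt a) (P.Cnormal a) (x + (p / (p - q)) • (P.vert b - x)) = 0 := by
    rw [ht_line, ← hp, ← hq]
    field_simp
    ring
  have h3 : ht (P.cpt b) (P.Cnormal b) (x + (p / (p - q)) • (P.vert b - x)) ≤ 0 :=
    P.cleave_sub a b _ hy hy0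
  rw [ht_line] at h3
  have := mul_pos ht0 h2
  have := mul_nonneg (sub_nonneg.2 ht1) hb
  linarith

theorem third_vert (a b : Fin P.nv) : ∃ c, c ≠ a ∧ c ≠ b := by
  set f := P.vface a 0
  have hm := P.m_ge f
  have h01 := P.fvert_inj f 0 1 (by norm_num) (by omega)
  have h02 := P.fvert_inj f 0 2 (by norm_num) (by omega)
  have h12 := P.fvert_inj f 1 2 (by norm_num) (by omega)
  by_contra hc
  push Not at hc
  have q0 := hc (P.fvert f 0)
  have q1 := hc (P.fvert f 1)
  have q2 := hc (P.fvert f 2)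
  by_cases r0 : P.fvert f 0 = a
  · have s1 := q1 (fun h => h01 (r0.trans h.symm))
    have s2 := q2 (fun h => h02 (r0.trans h.symm))
    exact h12 (s1.trans s2.symm)
  · have s0 := q0 r0
    by_cases r1 : P.fvert f 1 = a
    · have s2 := q2 (fun h => h12 (r1.trans h.symm))
      exact h02 (s0.trans s2.symm)
    · exact h01 (s0.trans (q1 r1).symm)

theorem strict_aux {a b : Fin P.nv} (hab : b ≠ a) {o : V3} (ho : o ∈ interior P.Pbar)
    (ha : ht (P.cpt a) (P.Cnormal a) o = 0) : ht (P.cpt b) (P.Cnormal b) o < 0 := by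
  have hle : ht (P.cpt b) (P.Cnormal b) o ≤ 0 := P.cleave_sub a b o (interior_subset ho) ha
  refine lt_of_le_of_ne hle fun hb => ?_
  set d := P.Cnormal a + P.Cnormal b with hd
  have hA := P.Cnormal_unit a
  have hB := P.Cnormal_unit b
  have hda : d ⬝ᵥ P.Cnormal a = 1 + P.Cnormal a ⬝ᵥ P.Cnormal b := by
    rw [hd, add_dotProduct, hA, dotProduct_comm (P.Cnormal b)]
  have hdb : d ⬝ᵥ P.Cnormal b = 1 + P.Cnormal a ⬝ᵥ P.Cnormal b := by
    rw [hd, add_dotProduct, hB, add_comm]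
  have hshift : ∀ c N x y : V3, ht c N (x + y) = ht c N x + y ⬝ᵥ N := by
    intro c N x y
    rw [ht, ht, ← add_dotProduct]; congr 1; abel
  by_cases hd0 : d = 0
  · obtain ⟨c, hca, hcb⟩ := P.third_vert a b
    have h1 : ht (P.cpt a) (P.Cnormal a) (P.vert c) < 0 := P.sep_other a c hca
    have h2 : ht (P.cpt b) (P.Cnormal b) (P.vert c) < 0 := P.sep_other b c hcb
    have h3 : P.vert c = o + (P.vert c - o) := by abel
    rw [h3, hshift, ha] at h1
    rw [h3, hshift, hb] at h2
    have h4 : (P.vert c - o) ⬝ᵥ d = 0 := by rw [hd0, dotProduct_zero]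
    rw [hd, dotProduct_add] at h4
    linarith
  · have hdd : 0 < d ⬝ᵥ d := by
      rcases lt_or_eq_of_le (show 0 ≤ d ⬝ᵥ d by
        rw [dot3]; nlinarith [mul_self_nonneg (d 0), mul_self_nonneg (d 1),
          mul_self_nonneg (d 2)]) with h | h
      · exact h
      · exact absurd (dotProduct_self_eq_zero.1 h.symm) hd0
    have hpos : 0 < 1 + P.Cnormal a ⬝ᵥ P.Cnormal b := by
      have : d ⬝ᵥ d = d ⬝ᵥ P.Cnormal a + d ⬝ᵥ P.Cnormal b := by
        rw [← dotProduct_add]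
      rw [hda, hdb] at this
      linarith
    have hcont : ContinuousAt (fun ε : ℝ => o + ε • d) 0 := by fun_prop
    have hev : ∀ᶠ ε in nhds (0 : ℝ), o + ε • d ∈ P.Pbar := by
      apply hcont
      simp only [zero_smul, add_zero]
      exact mem_interior_iff_mem_nhds.1 ho
    obtain ⟨δ, hδ, hball⟩ := Metric.eventually_nhds_iff.1 hev
    have hmem : o + (δ / 2) • d ∈ P.Pbar := hball (by
      rw [Real.dist_eq, sub_zero, abs_of_pos (by linarith)]; linarith)
    have h5 : 0 < (δ / 2) * (1 + P.Cnormal a ⬝ᵥ P.Cnormal b) := mul_pos (by linarith) hpos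
    have h6 : ht (P.cpt a) (P.Cnormal a) (o + (δ / 2) • d) ≤ 0 := P.excl_aux hab hmem (by
      rw [hshift, hb, smul_dotProduct, hdb, smul_eq_mul]; linarith)
    rw [hshift, ha, smul_dotProduct, hda, smul_eq_mul] at h6
    linarith

theorem notvert_of {a : Fin P.nv} {x : V3} (h : ht (P.cpt a) (P.Cnormal a) x = 0) :
    x ∉ Set.range P.vert := by
  rintro ⟨b, rfl⟩
  by_cases hb : b = a
  · subst hb
    have : 0 < ht (P.cpt b) (P.Cnormal b) (P.vert b) := P.sep_vert b
    linarith
  · have : ht (P.cpt a) (P.Cnormal a) (P.vert b) < 0 := P.sep_other a b hb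
    linarith

theorem bdChat_iff (a : Fin P.nv) (x : V3) :
    x ∈ P.bdChat a ↔ x ∈ frontier P.Pbar ∧ ht (P.cpt a) (P.Cnormal a) x = 0 := by
  constructor
  · intro hx
    obtain ⟨c, hc⟩ := Set.mem_iUnion.1 hx
    refine ⟨?_, hc.1.1⟩
    rw [P.frontier_eq]
    exact Set.mem_iUnion.2 ⟨c, hc.2.1⟩
  · rintro ⟨hf, h0⟩
    have hK : x ∈ P.Pbar := P.compact.isClosed.frontier_subset hf
    rw [P.frontier_eq] at hf
    obtain ⟨c, hc⟩ := Set.mem_iUnion.1 hf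
    refine Set.mem_iUnion.2 ⟨c, ⟨h0, hK, P.notvert_of h0⟩, hc, ?_⟩
    exact Set.mem_iInter.2 fun b => P.cleave_sub a b x hK h0

theorem mem_Phat_iff (x : V3) : x ∈ P.PhatSet ↔
    x ∈ P.Pbar ∧ ∀ a, ht (P.cpt a) (P.Cnormal a) x ≤ 0 := by
  constructor
  · rintro ⟨h1, h2⟩
    exact ⟨h1.1, fun a => Set.mem_iInter.1 h2 a⟩
  · rintro ⟨h1, h2⟩
    refine ⟨⟨h1, ?_⟩, Set.mem_iInter.2 h2⟩
    rintro ⟨b, rfl⟩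
    have : 0 < ht (P.cpt b) (P.Cnormal b) (P.vert b) := P.sep_vert b
    linarith [h2 b]

theorem Phat_eq : P.PhatSet = P.Pbar ∩ ⋂ a, {x | ht (P.cpt a) (P.Cnormal a) x ≤ 0} := by
  ext x
  rw [P.mem_Phat_iff]
  simp

theorem Phat_compact : IsCompact P.PhatSet := by
  rw [P.Phat_eq]
  exact P.compact.inter_right
    (isClosed_iInter fun a => isClosed_le (ht_cont _ _) continuous_const)

theorem Phat_convex : Convex ℝ P.PhatSet := by
  rw [P.Phat_eq]
  refine P.convex.inter (convex_iInter fun a => ?_)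
  intro x hx y hy p q hp hq hpq
  simp only [Set.mem_ofPred_eq] at hx hy ⊢
  have hp' : p = 1 - q := by linarith
  have : p • x + q • y = x + q • (y - x) := by
    rw [hp', sub_smul, one_smul, smul_sub]; abel
  rw [this, ht_line, ← hp']
  have := mul_nonneg hp (neg_nonneg.2 hx)
  have := mul_nonneg hq (neg_nonneg.2 hy)
  linarith

end PolyCtx

/-- The wrapping numbers of `n̂ ∈ C⁰(P̂)` over all cleaved faces sum
to zero. -/
theorem stmt_2 (P : PolyCtx) (deg : (V3 → V3) → ℤ) (hdeg : DegreeTheory deg)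
    (s : V3) (hs : P.AdmissibleS s) (n : V3 → V3) (hn : P.MemC0Phat n)
    (w : Fin P.nv → ℤ) (hw : ∀ a, P.HasWrap deg s a n (w a)) :
    ∑ a, w a = 0 := by
  choose ctr z hctr hctr' hloop hrange hdegw using hw
  have hzc : ∀ a, Continuous (z a) := fun a => (hloop a).1
  have hzp : ∀ a φ, z a (φ + 2 * Real.pi) = z a φ := fun a => (hloop a).2.1
  choose e1 e2 h11 h22 h12 hcr θ r hθ hθm hθp hr hz using fun a => (hloop a).2.2
  have hfr : ∀ a, OFrame (e1 a) (e2 a) (P.Cnormal a) := fun a =>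
    ⟨h11 a, h22 a, h12 a, hcr a⟩
  have hc0 : ∀ a, ht (P.cpt a) (P.Cnormal a) (ctr a) = 0 := fun a => (hctr a).1
  have hht : ∀ a x, ht (ctr a) (P.Cnormal a) x = ht (P.cpt a) (P.Cnormal a) x := by
    intro a x
    have h1 := hc0 a
    rw [ht] at h1 ⊢
    have h2 : x - ctr a = (x - P.cpt a) - (ctr a - P.cpt a) := by abel
    rw [h2, sub_dotProduct, h1, sub_zero, ht]
  have hci : ∀ a, ctr a ∈ interior P.Pbar := by
    intro a
    rw [← self_sdiff_frontier]
    exact ⟨(hctr a).2.1, fun h => hctr' a ((P.bdChat_iff a _).2 ⟨h, hc0 a⟩)⟩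
  have T : TruncBody P.Pbar P.Cnormal ctr e1 e2 :=
    { cpt := P.compact
      cvx := P.convex
      frame := hfr
      ctr_int := hci
      ctr_neg := fun a b hb => by
        rw [hht]; exact P.strict_aux hb (hci a) (hc0 a)
      cleave := fun a b x hx h => by
        rw [hht] at h ⊢; exact P.cleave_sub a b x hx h
      excl := fun a b hab x hx h1 h2 => by
        rw [hht] at h1 h2
        rw [hht, hht]
        exact ⟨le_antisymm (P.excl_aux hab.symm hx h2) h1,
          le_antisymm (P.excl_aux hab hx h1) h2⟩ }
  obtain ⟨hncont, hnS, hntan⟩ := hn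
  obtain ⟨R, hR, hRm, hRs, hRd⟩ := rot_exists hs.1
  obtain ⟨Ψ, hΨ, hΨl⟩ := aux_spin_lift P.Phat_compact P.Phat_convex (fun x => R (n x))
    (hR.comp_continuousOn hncont) (fun x hx => hRm (hnS x hx))
  set G : Set V3 := frontier P.Pbar ∩ {x | ∀ a, ht (ctr a) (P.Cnormal a) x ≤ 0} with hG
  have hGP : ∀ x ∈ G, x ∈ P.PhatSet := by
    intro x hx
    rw [P.mem_Phat_iff]
    refine ⟨T.fr_sub hx.1, fun a => ?_⟩
    rw [← hht]; exact hx.2 a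
  have hGn : ∀ x ∈ G, n x ≠ s ∧ n x ≠ -s := by
    intro x hx
    have hf := hx.1
    rw [P.frontier_eq] at hf
    obtain ⟨c, hc⟩ := Set.mem_iUnion.1 hf
    have h0 := hntan c x ⟨hc, (hGP x hx).2⟩
    constructor
    · intro h; rw [h] at h0; exact hs.2 c h0
    · intro h; rw [h, neg_dotProduct, neg_eq_zero] at h0; exact hs.2 c h0
  have hune : ∀ x ∈ G, (Ψ x).1 ≠ 0 := fun x hx =>
    (hΨl x (hGP x hx)).fst_ne fun h => (hGn x hx).1 (hRs _ h)
  have huc : ContinuousOn (fun x => (Ψ x).1) G :=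
    continuous_fst.comp_continuousOn (hΨ.mono hGP)
  have hbG : ∀ a, MapsTo (bt P.Pbar (e1 a) (e2 a) (ctr a)) (Metric.sphere 0 1) G := by
    intro a ω hω
    exact ⟨T.bt_fr a hω, fun b => T.cleave a b _ (T.fr_sub (T.bt_fr a hω)) (T.bt_ht a ω)⟩
  have hkex : ∀ a, ∃ k, HW (fun ω => (Ψ (bt P.Pbar (e1 a) (e2 a) (ctr a) ω)).1) k := by
    intro a
    exact HW_exists _ (huc.comp (T.bt_cont a) (hbG a)) (fun ω hω => hune _ (hbG a hω))
  choose k hk using hkex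
  have hzb : ∀ a φ, z a φ ∈ frontier P.Pbar ∧ ht (P.cpt a) (P.Cnormal a) (z a φ) = 0 := by
    intro a φ
    rw [← P.bdChat_iff, ← hrange a]
    exact Set.mem_range_self φ
  have hzG : ∀ a φ, z a φ ∈ G := by
    intro a φ
    refine ⟨(hzb a φ).1, fun b => ?_⟩
    rw [hht]
    exact P.cleave_sub a b _ (T.fr_sub (hzb a φ).1) (hzb a φ).2
  have hzbt : ∀ a φ, bt P.Pbar (e1 a) (e2 a) (ctr a) (Complex.exp ((θ a φ : ℂ) * Complex.I)) =
      z a φ := by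
    intro a φ
    refine radp_eq P.convex (hci a) (hr a φ) (hzb a φ).1 ?_
    rw [hz a φ, pl, Complex.exp_ofReal_mul_I_re, Complex.exp_ofReal_mul_I_im]
  have hwk : ∀ a, w a = k a := by
    intro a
    rw [← hdegw a]
    have h1 := (hk a).transfer (θ a) (hθ a) (hθp a)
    have h2 : HW (fun ω => (Ψ (z a (Complex.arg ω))).1) (k a) := by
      refine h1.congr fun ω _ => ?_
      simp only [hzbt]
    exact wrap_deg hdeg hs.1 hR hRm hRs (hRd deg hdeg) P.Phat_convex hncont hnS hΨ hΨl (hzc a)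
      (hzp a) (fun φ => hGP _ (hzG a φ))
      ((P.mem_Phat_iff _).2 ⟨(hctr a).2.1, fun b =>
        P.cleave_sub a b _ (hctr a).2.1 (hc0 a)⟩)
      (fun φ => (hGn _ (hzG a φ)).1) (fun φ => (hGn _ (hzG a φ)).2) h2
  rw [Finset.sum_congr rfl fun a _ => hwk a]
  exact T.sum_zero (fun x => (Ψ x).1) huc hune k hk
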